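/- arXiv:2405.15634 — 12 statements merged into one kernel-verified Lean document; each statement's English description precedes it below -/
import Mathlib

section
/- Proposition 1.1 (combinatorial Cohen–Macaulay criteria, parts (d)⟺(e)): The following two conditions are equivalent: (d) for every q₁ ∈ Ap_1 and every q₂ ∈ Ap_2 with q₁ + q₂ ≡ 0 (mod d), one has (q₁, q₂) ∈ S; (e) for every s ∈ ℤ × ℤ, if s + (0, d) ∈ S and s + (d, 0) ∈ S, then s ∈ S (where S is regarded as a subset of ℤ × ℤ via the inclusion ℕ × ℕ ⊆ ℤ × ℤ). -/
/-- The Apery set of a submonoid `S ⊆ ℕ` with respect to `d`: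
elements `y ∈ S` such that `y - d ∉ S`. -/
def AperyN (S : AddSubmonoid ℕ) (d : ℕ) : Set ℕ :=
  {y | y ∈ S ∧ ¬ ∃ s ∈ S, y = s + d}

/-- The Apery set of a submonoid `S ⊆ ℕ × ℕ` with respect to `(0,d)` and `(d,0)`. -/
def AperyP (S : AddSubmonoid (ℕ × ℕ)) (d : ℕ) : Set (ℕ × ℕ) :=
  {y | y ∈ S ∧ (¬ ∃ s ∈ S, y = s + ((0 : ℕ), d)) ∧ (¬ ∃ s ∈ S, y = s + (d, (0 : ℕ)))}

/-- The partial order induced by a submonoid of `ℕ`. -/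
def leN (S : AddSubmonoid ℕ) (y z : ℕ) : Prop := ∃ s ∈ S, z = y + s

/-- The partial order induced by a submonoid of `ℕ × ℕ`. -/
def leP (S : AddSubmonoid (ℕ × ℕ)) (y z : ℕ × ℕ) : Prop := ∃ s ∈ S, z = y + s

/-- The numerical semigroup `S₁` generated by `a 1, …, a n`. -/
def Smon1 (n : ℕ) (a : ℕ → ℕ) : AddSubmonoid ℕ :=
  AddSubmonoid.closure {x | ∃ i, 1 ≤ i ∧ i ≤ n ∧ x = a i}

/-- The numerical semigroup `S₂` generated by `d - a 0, …, d - a (n-1)`. -/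
def Smon2 (n d : ℕ) (a : ℕ → ℕ) : AddSubmonoid ℕ :=
  AddSubmonoid.closure {x | ∃ i, i < n ∧ x = d - a i}

/-- The monoid `S ⊆ ℕ × ℕ` generated by the `(a i, d - a i)`, `i = 0, …, n`. -/
def SmonH (n d : ℕ) (a : ℕ → ℕ) : AddSubmonoid (ℕ × ℕ) :=
  AddSubmonoid.closure {p | ∃ i, i ≤ n ∧ p = (a i, d - a i)}

/-- The image of `SmonH` inside `ℤ × ℤ`. -/
def SmonHZ (n d : ℕ) (a : ℕ → ℕ) : Set (ℤ × ℤ) :=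
  {p | ∃ q ∈ SmonH n d a, p = ((q.1 : ℤ), (q.2 : ℤ))}

theorem exists_mem_AperyN_add_mul {M : AddSubmonoid ℕ} {d : ℕ} (hd : 0 < d) (y : ℕ)
    (hy : y ∈ M) : ∃ q ∈ AperyN M d, ∃ k, y = q + k * d := by
  induction y using Nat.strong_induction_on with
  | _ y ih =>
    by_cases h : ∃ s ∈ M, y = s + d
    · obtain ⟨s, hs, rfl⟩ := h
      obtain ⟨q, hq, k, rfl⟩ := ih s (by omega) hs
      exact ⟨q, hq, k + 1, by ring⟩
    · exact ⟨y, ⟨hy, h⟩, 0, by simp⟩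

theorem add_mul_mem {S : AddSubmonoid (ℕ × ℕ)} {d : ℕ} (h₁ : (d, 0) ∈ S) (h₂ : (0, d) ∈ S)
    {x y : ℕ} (h : (x, y) ∈ S) (i j : ℕ) : (x + i * d, y + j * d) ∈ S := by
  have := S.add_mem h (S.add_mem (S.nsmul_mem h₁ i) (S.nsmul_mem h₂ j))
  simpa using this

/-- One-step cancellation of `(d, 0)` and `(0, d)` implies cancellation of their multiples. -/
theorem mem_of_add_mul_mem {S : AddSubmonoid (ℕ × ℕ)} {d : ℕ} (h₁ : (d, 0) ∈ S)
    (h₂ : (0, d) ∈ S)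
    (hS : ∀ x y, (x, y + d) ∈ S → (x + d, y) ∈ S → (x, y) ∈ S) (k l x y : ℕ)
    (hk : (x, y + k * d) ∈ S) (hl : (x + l * d, y) ∈ S) : (x, y) ∈ S := by
  have one : ∀ k x, (x, y + k * d) ∈ S → (x + d, y) ∈ S → (x, y) ∈ S := by
    intro k
    induction k with
    | zero => intro x h _; simpa using h
    | succ k ih =>
      intro x h h'
      refine ih x (hS _ _ ?_ ?_) h'
      · convert h using 2; ring
      · simpa using add_mul_mem h₁ h₂ h' 0 k
  induction l with
  | zero => simpa using hl
  | succ l ih =>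
    refine ih (one k _ ?_ ?_)
    · simpa using add_mul_mem h₁ h₂ hk l 0
    · convert hl using 2; ring

theorem mem_of_mem_SmonH {n d : ℕ} {a : ℕ → ℕ} (h0 : a 0 = 0) (han : a n = d)
    (hle : ∀ i ≤ n, a i ≤ d) {p : ℕ × ℕ} (hp : p ∈ SmonH n d a) :
    p.1 ∈ Smon1 n a ∧ p.2 ∈ Smon2 n d a ∧ d ∣ p.1 + p.2 := by
  induction hp using AddSubmonoid.closure_induction with
  | mem p hp =>
    obtain ⟨i, hi, rfl⟩ := hp
    refine ⟨?_, ?_, ?_⟩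
    · rcases Nat.eq_zero_or_pos i with rfl | hpos
      · simp [h0]
      · exact AddSubmonoid.subset_closure ⟨i, hpos, hi, rfl⟩
    · rcases hi.eq_or_lt with rfl | hlt
      · simp [han]
      · exact AddSubmonoid.subset_closure ⟨i, hlt, rfl⟩
    · simp [Nat.add_sub_cancel' (hle i hi)]
  | zero => simp
  | add p q _ _ hp hq =>
    refine ⟨add_mem hp.1 hq.1, add_mem hp.2.1 hq.2.1, ?_⟩
    have := dvd_add hp.2.2 hq.2.2
    rwa [add_add_add_comm] at this

theorem exists_mem_SmonH_of_mem_Smon1 {n d : ℕ} {a : ℕ → ℕ} {x : ℕ} (hx : x ∈ Smon1 n a) :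
    ∃ y, (x, y) ∈ SmonH n d a := by
  induction hx using AddSubmonoid.closure_induction with
  | mem x hx =>
    obtain ⟨i, _, hi, rfl⟩ := hx
    exact ⟨_, AddSubmonoid.subset_closure ⟨i, hi, rfl⟩⟩
  | zero => exact ⟨0, zero_mem _⟩
  | add x x' _ _ h h' =>
    obtain ⟨y, hy⟩ := h
    obtain ⟨y', hy'⟩ := h'
    exact ⟨y + y', add_mem hy hy'⟩

theorem exists_mem_SmonH_of_mem_Smon2 {n d : ℕ} {a : ℕ → ℕ} {y : ℕ} (hy : y ∈ Smon2 n d a) :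
    ∃ x, (x, y) ∈ SmonH n d a := by
  induction hy using AddSubmonoid.closure_induction with
  | mem y hy =>
    obtain ⟨i, hi, rfl⟩ := hy
    exact ⟨_, AddSubmonoid.subset_closure ⟨i, hi.le, rfl⟩⟩
  | zero => exact ⟨0, zero_mem _⟩
  | add y y' _ _ h h' =>
    obtain ⟨x, hx⟩ := h
    obtain ⟨x', hx'⟩ := h'
    exact ⟨x + x', add_mem hx hx'⟩

theorem natCast_mem_SmonHZ {n d : ℕ} {a : ℕ → ℕ} {x y : ℕ} :
    ((x : ℤ), (y : ℤ)) ∈ SmonHZ n d a ↔ (x, y) ∈ SmonH n d a := by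
  constructor
  · rintro ⟨⟨x', y'⟩, h, e⟩
    simp only [Prod.mk.injEq, Nat.cast_inj] at e
    rwa [e.1, e.2]
  · exact fun h => ⟨_, h, rfl⟩

theorem exists_add_mul_eq_add_mul {d x y z : ℕ} (hy : d ∣ x + y) (hz : d ∣ x + z) :
    ∃ i k, y + i * d = z + k * d := by
  obtain ⟨b, hb⟩ := hy
  obtain ⟨c, hc⟩ := hz
  refine ⟨c, b, ?_⟩
  linarith [mul_comm b d, mul_comm c d]

/-- Proposition 1.1, (d) ⟺ (e). -/
theorem stmt0 (n d : ℕ) (a : ℕ → ℕ) (hd : 0 < d) (hn : 2 ≤ n)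
    (h0 : a 0 = 0) (han : a n = d)
    (hmono : ∀ i j, i < j → j ≤ n → a i < a j)
    (hgcd : Finset.gcd (Finset.Icc 1 n) a = 1) :
    (∀ q₁ ∈ AperyN (Smon1 n a) d, ∀ q₂ ∈ AperyN (Smon2 n d a) d,
        (q₁ + q₂) % d = 0 → ((q₁, q₂) : ℕ × ℕ) ∈ SmonH n d a)
    ↔
    (∀ s : ℤ × ℤ, s + ((0 : ℤ), (d : ℤ)) ∈ SmonHZ n d a →
        s + ((d : ℤ), (0 : ℤ)) ∈ SmonHZ n d a → s ∈ SmonHZ n d a) := by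
  have hle : ∀ i ≤ n, a i ≤ d := by
    intro i hi
    rcases hi.eq_or_lt with rfl | h
    · exact han.le
    · exact han ▸ (hmono i n h le_rfl).le
  have h₁ : (d, 0) ∈ SmonH n d a := AddSubmonoid.subset_closure ⟨n, le_rfl, by simp [han]⟩
  have h₂ : (0, d) ∈ SmonH n d a := AddSubmonoid.subset_closure ⟨0, n.zero_le, by simp [h0]⟩
  constructor
  · rintro H ⟨u, v⟩ hv hu
    simp only [Prod.mk_add_mk, add_zero] at hv hu
    obtain ⟨u, rfl⟩ : ∃ m : ℕ, u = m := by
      obtain ⟨p, _, e⟩ := hv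
      exact ⟨p.1, congrArg Prod.fst e⟩
    obtain ⟨v, rfl⟩ : ∃ m : ℕ, v = m := by
      obtain ⟨p, _, e⟩ := hu
      exact ⟨p.2, congrArg Prod.snd e⟩
    rw [← Nat.cast_add, natCast_mem_SmonHZ] at hv hu
    rw [natCast_mem_SmonHZ]
    obtain ⟨hu₁, -, hdvd⟩ := mem_of_mem_SmonH h0 han hle hv
    obtain ⟨-, hv₂, -⟩ := mem_of_mem_SmonH h0 han hle hu
    obtain ⟨q₁, hq₁, i, rfl⟩ := exists_mem_AperyN_add_mul hd u hu₁
    obtain ⟨q₂, hq₂, j, rfl⟩ := exists_mem_AperyN_add_mul hd v hv₂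
    refine add_mul_mem h₁ h₂ (H q₁ hq₁ q₂ hq₂ (Nat.mod_eq_zero_of_dvd ?_)) i j
    have e : q₁ + i * d + (q₂ + j * d + d) = q₁ + q₂ + (i + j + 1) * d := by ring
    rw [e] at hdvd
    exact (Nat.dvd_add_left (dvd_mul_left d _)).1 hdvd
  · intro H q₁ hq₁ q₂ hq₂ hmod
    have hdvd := Nat.dvd_of_mod_eq_zero hmod
    obtain ⟨y, hy⟩ := exists_mem_SmonH_of_mem_Smon1 (d := d) hq₁.1
    obtain ⟨x, hx⟩ := exists_mem_SmonH_of_mem_Smon2 hq₂.1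
    obtain ⟨j, k, hk⟩ :=
      exists_add_mul_eq_add_mul (mem_of_mem_SmonH h0 han hle hy).2.2 hdvd
    obtain ⟨i, l, hl⟩ := exists_add_mul_eq_add_mul
      (add_comm x q₂ ▸ (mem_of_mem_SmonH h0 han hle hx).2.2) (add_comm q₁ q₂ ▸ hdvd)
    refine mem_of_add_mul_mem h₁ h₂ (fun x y h h' => ?_) k l q₁ q₂ ?_ ?_
    · refine natCast_mem_SmonHZ.1 (H _ ?_ ?_)
      · simpa using natCast_mem_SmonHZ.2 h
      · simpa using natCast_mem_SmonHZ.2 h'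
    · simpa [hk] using add_mul_mem h₁ h₂ hy 0 j
    · simpa [hl] using add_mul_mem h₁ h₂ hx i 0
end

section
/- Proposition 1.4 (a.1): For all y, z ∈ Ap_1, the element z covers y in the poset (Ap_1, ≤_1) if and only if z = y + a for some a ∈ MSG(S_1) ∖ {a_n}. -/
/-- `z` covers `y` in the poset `(AperyN S d, leN S)`. -/
def coversN (S : AddSubmonoid ℕ) (d : ℕ) (y z : ℕ) : Prop :=
  y ∈ AperyN S d ∧ z ∈ AperyN S d ∧ (leN S y z ∧ y ≠ z) ∧
    ¬ ∃ w ∈ AperyN S d, (leN S y w ∧ y ≠ w) ∧ (leN S w z ∧ w ≠ z)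

/-- `z` covers `y` in the poset `(AperyP S d, leP S)`. -/
def coversP (S : AddSubmonoid (ℕ × ℕ)) (d : ℕ) (y z : ℕ × ℕ) : Prop :=
  y ∈ AperyP S d ∧ z ∈ AperyP S d ∧ (leP S y z ∧ y ≠ z) ∧
    ¬ ∃ w ∈ AperyP S d, (leP S y w ∧ y ≠ w) ∧ (leP S w z ∧ w ≠ z)

/-- The poset `(AperyN S d, leN S)` is graded. -/
def gradedN (S : AddSubmonoid ℕ) (d : ℕ) : Prop :=
  ∃ ρ : ℕ → ℕ, ∀ y z, coversN S d y z → ρ z = ρ y + 1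

/-- The minimal system of generators of a submonoid `S ⊆ ℕ`: nonzero elements of `S`
that are not the sum of two nonzero elements of `S`. -/
def MSG (S : AddSubmonoid ℕ) : Set ℕ :=
  {x | x ∈ S ∧ x ≠ 0 ∧ ¬ ∃ u v : ℕ, u ∈ S ∧ v ∈ S ∧ u ≠ 0 ∧ v ≠ 0 ∧ x = u + v}

/-- The Apery set is downward closed in `S` for the order induced by `S`. -/
theorem mem_AperyN_of_add_mem {S : AddSubmonoid ℕ} {d w t : ℕ} (hw : w ∈ S) (ht : t ∈ S)
    (h : w + t ∈ AperyN S d) : w ∈ AperyN S d := by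
  refine ⟨hw, ?_⟩
  rintro ⟨s, hs, rfl⟩
  exact h.2 ⟨s + t, S.add_mem hs ht, by omega⟩

/-- Covers in the Apery set are the translates by minimal generators other than `d`. -/
theorem coversN_iff {S : AddSubmonoid ℕ} {d y z : ℕ} (hy : y ∈ AperyN S d)
    (hz : z ∈ AperyN S d) :
    coversN S d y z ↔ ∃ b ∈ MSG S, b ≠ d ∧ z = y + b := by
  constructor
  · rintro ⟨-, -, ⟨⟨b, hb, rfl⟩, hne⟩, hcov⟩
    refine ⟨b, ⟨hb, by omega, ?_⟩, ?_, rfl⟩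
    · rintro ⟨u, v, hu, hv, hu0, hv0, rfl⟩
      refine hcov ⟨y + u, ?_, ⟨⟨u, hu, rfl⟩, by omega⟩, ⟨v, hv, by omega⟩, by omega⟩
      exact mem_AperyN_of_add_mem (S.add_mem hy.1 hu) hv (by rwa [add_assoc])
    · rintro rfl
      exact hz.2 ⟨y, hy.1, rfl⟩
  · rintro ⟨b, ⟨hb, hb0, hirr⟩, -, rfl⟩
    refine ⟨hy, hz, ⟨⟨b, hb, rfl⟩, by omega⟩, ?_⟩
    rintro ⟨w, -, ⟨⟨u, hu, rfl⟩, hne⟩, ⟨v, hv, huv⟩, hne'⟩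
    exact hirr ⟨u, v, hu, hv, by omega, by omega, by omega⟩

/-- Proposition 1.4 (a.1): the covering relation in `(Ap₁, ≤₁)`. -/
theorem stmt3 (n d : ℕ) (a : ℕ → ℕ) (hd : 0 < d) (hn : 2 ≤ n)
    (h0 : a 0 = 0) (han : a n = d)
    (hmono : ∀ i j, i < j → j ≤ n → a i < a j)
    (hgcd : Finset.gcd (Finset.Icc 1 n) a = 1) :
    ∀ y ∈ AperyN (Smon1 n a) d, ∀ z ∈ AperyN (Smon1 n a) d,
      (coversN (Smon1 n a) d y z ↔
        ∃ b ∈ MSG (Smon1 n a), b ≠ a n ∧ z = y + b) := by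
  intro y hy z hz
  rw [han]
  exact coversN_iff hy hz
end

section
/- Proposition 1.4 (b.1): For all y, z ∈ AP_S, the element z covers y in the poset (AP_S, ≤_S) if and only if z = y + (a_i, d − a_i) for some i ∈ {1, …, n − 1}. -/
theorem mem_SmonH (n d : ℕ) (a : ℕ → ℕ) {i : ℕ} (hi : i ≤ n) :
    (a i, d - a i) ∈ SmonH n d a :=
  AddSubmonoid.subset_closure ⟨i, hi, rfl⟩

/-- A nonzero element of `SmonH n d a` is a generator plus an element of `SmonH n d a`. -/
theorem SmonH_eq_zero_or_exists_add {n d : ℕ} {a : ℕ → ℕ} {s : ℕ × ℕ} (hs : s ∈ SmonH n d a) :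
    s = 0 ∨ ∃ i ≤ n, ∃ t ∈ SmonH n d a, s = (a i, d - a i) + t := by
  refine AddSubmonoid.closure_induction (motive := fun s _ => s = 0 ∨ ∃ i ≤ n, ∃ t ∈ SmonH n d a,
    s = (a i, d - a i) + t) ?_ (Or.inl rfl) ?_ hs
  · rintro _ ⟨i, hi, rfl⟩
    exact Or.inr ⟨i, hi, 0, zero_mem _, (add_zero _).symm⟩
  · rintro x y - hy (rfl | ⟨i, hi, t, ht, rfl⟩) ihy
    · simpa using ihy
    · exact Or.inr ⟨i, hi, t + y, add_mem ht hy, add_assoc _ _ _⟩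

/-- The coordinate sum of an element of `SmonH n d a` is a multiple of `d`. -/
theorem dvd_fst_add_snd_of_mem_SmonH {n d : ℕ} {a : ℕ → ℕ} (ha : ∀ i ≤ n, a i ≤ d)
    {s : ℕ × ℕ} (hs : s ∈ SmonH n d a) : d ∣ s.1 + s.2 := by
  refine AddSubmonoid.closure_induction (motive := fun s _ => d ∣ s.1 + s.2) ?_ (by simp) ?_ hs
  · rintro _ ⟨i, hi, rfl⟩
    simp [Nat.add_sub_cancel' (ha i hi)]
  · intro x y _ _ hx hy
    simpa [add_add_add_comm] using dvd_add hx hy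

theorem le_fst_add_snd_of_mem_SmonH {n d : ℕ} {a : ℕ → ℕ} (ha : ∀ i ≤ n, a i ≤ d)
    {s : ℕ × ℕ} (hs : s ∈ SmonH n d a) (h : s ≠ 0) : d ≤ s.1 + s.2 := by
  refine Nat.le_of_dvd (Nat.pos_of_ne_zero fun h' => h ?_) (dvd_fst_add_snd_of_mem_SmonH ha hs)
  exact Prod.ext (by simp; omega) (by simp; omega)

/-- The Apery set is a lower set for the order induced by `S` on `S`. -/
theorem mem_AperyP_of_add_mem {S : AddSubmonoid (ℕ × ℕ)} {d : ℕ} {w t : ℕ × ℕ}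
    (hw : w ∈ S) (ht : t ∈ S) (h : w + t ∈ AperyP S d) : w ∈ AperyP S d := by
  refine ⟨hw, ?_, ?_⟩
  · rintro ⟨s, hs, rfl⟩
    exact h.2.1 ⟨s + t, add_mem hs ht, add_right_comm _ _ _⟩
  · rintro ⟨s, hs, rfl⟩
    exact h.2.2 ⟨s + t, add_mem hs ht, add_right_comm _ _ _⟩

/-- Proposition 1.4 (b.1): the covering relation in `(AP_S, ≤_S)`. -/
theorem stmt5 (n d : ℕ) (a : ℕ → ℕ) (hd : 0 < d) (hn : 2 ≤ n)
    (h0 : a 0 = 0) (han : a n = d)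
    (hmono : ∀ i j, i < j → j ≤ n → a i < a j)
    (hgcd : Finset.gcd (Finset.Icc 1 n) a = 1) :
    ∀ y ∈ AperyP (SmonH n d a) d, ∀ z ∈ AperyP (SmonH n d a) d,
      (coversP (SmonH n d a) d y z ↔
        ∃ i, 1 ≤ i ∧ i ≤ n - 1 ∧ z = y + (a i, d - a i)) := by
  intro y hy z hz
  have ha : ∀ i ≤ n, a i ≤ d := fun i hi => by
    rcases hi.eq_or_lt with rfl | hi
    · exact han.le
    · exact han ▸ (hmono i n hi le_rfl).le
  constructor
  · rintro ⟨-, -, ⟨⟨s, hs, rfl⟩, hne⟩, hcov⟩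
    rcases SmonH_eq_zero_or_exists_add hs with rfl | ⟨i, hi, t, ht, rfl⟩
    · simp at hne
    have hg := mem_SmonH n d a hi
    have hi0 : i ≠ 0 := by
      rintro rfl
      refine hz.2.1 ⟨y + t, add_mem hy.1 ht, ?_⟩
      rw [h0, Nat.sub_zero]
      abel
    have hin : i ≠ n := by
      rintro rfl
      refine hz.2.2 ⟨y + t, add_mem hy.1 ht, ?_⟩
      rw [han, Nat.sub_self]
      abel
    refine ⟨i, by omega, by omega, ?_⟩
    by_contra hzne
    have hpos := hmono 0 i (by omega) hi
    have hw : y + (a i, d - a i) ∈ AperyP (SmonH n d a) d :=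
      mem_AperyP_of_add_mem (add_mem hy.1 hg) ht (by rwa [add_assoc])
    refine hcov ⟨_, hw, ⟨⟨_, hg, rfl⟩, fun h => ?_⟩, ⟨t, ht, (add_assoc _ _ _).symm⟩,
      Ne.symm hzne⟩
    have := congrArg Prod.fst h
    simp only [Prod.fst_add] at this
    omega
  · rintro ⟨i, hi1, hin, rfl⟩
    have hpos := hmono 0 i (by omega) (by omega)
    refine ⟨hy, hz, ⟨⟨_, mem_SmonH n d a (by omega), rfl⟩, fun h => ?_⟩, ?_⟩
    · have := congrArg Prod.fst h
      simp only [Prod.fst_add] at this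
      omega
    · rintro ⟨_, -, ⟨⟨s, hs, rfl⟩, hys⟩, ⟨t, ht, hst⟩, hne⟩
      have hsd := le_fst_add_snd_of_mem_SmonH ha hs (by rintro rfl; simp at hys)
      have htd := le_fst_add_snd_of_mem_SmonH ha ht
        (by rintro rfl; exact hne (by rw [hst, add_zero]))
      have hai := ha i (by omega)
      have h1 := congrArg Prod.fst hst
      have h2 := congrArg Prod.snd hst
      simp only [Prod.fst_add, Prod.snd_add] at h1 h2
      omega
end

section
/- Proposition 1.4 (b.2): Every element (y₁, y₂) of S satisfies d ∣ (y₁ + y₂), and the poset (AP_S, ≤_S) is graded with rank function ρ : AP_S → ℕ given by ρ(y₁, y₂) = (y₁ + y₂)/d; that is, whenever z covers y in (AP_S, ≤_S), one has ρ(z) = ρ(y) + 1. -/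
theorem add_snd_eq_of_generator {n d : ℕ} {a : ℕ → ℕ} (han : a n = d)
    (hmono : ∀ i j, i < j → j ≤ n → a i < a j) {p : ℕ × ℕ}
    (hp : ∃ i, i ≤ n ∧ p = (a i, d - a i)) : p.1 + p.2 = d := by
  obtain ⟨i, hi, rfl⟩ := hp
  have : a i ≤ d := by
    rcases hi.lt_or_eq with h | rfl
    · exact han ▸ (hmono i n h le_rfl).le
    · exact han.le
  simp only
  omega

theorem SmonH_eq_zero_or_exists_generator_add {n d : ℕ} {a : ℕ → ℕ} {s : ℕ × ℕ}
    (hs : s ∈ SmonH n d a) :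
    s = 0 ∨ ∃ g, (∃ i, i ≤ n ∧ g = (a i, d - a i)) ∧ ∃ t ∈ SmonH n d a, s = g + t := by
  refine AddSubmonoid.closure_induction_left (Or.inl rfl) ?_ hs
  exact fun g hg t ht _ => Or.inr ⟨g, hg, t, ht, rfl⟩

/-- Proposition 1.4 (b.2): every element `(y₁, y₂)` of `S` satisfies `d ∣ y₁ + y₂`, and
`(AP_S, ≤_S)` is graded with rank function `(y₁, y₂) ↦ (y₁ + y₂) / d`. -/
theorem stmt6 (n d : ℕ) (a : ℕ → ℕ) (hd : 0 < d) (hn : 2 ≤ n)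
    (h0 : a 0 = 0) (han : a n = d)
    (hmono : ∀ i j, i < j → j ≤ n → a i < a j)
    (hgcd : Finset.gcd (Finset.Icc 1 n) a = 1) :
    (∀ y ∈ SmonH n d a, d ∣ y.1 + y.2)
    ∧
    (∀ y z, coversP (SmonH n d a) d y z →
      (z.1 + z.2) / d = (y.1 + y.2) / d + 1) := by
  refine ⟨fun y hy => ?_, ?_⟩
  · refine AddSubmonoid.closure_induction (motive := fun x _ => d ∣ x.1 + x.2) ?_ ?_ ?_ hy
    · exact fun p hp => (add_snd_eq_of_generator han hmono hp).symm ▸ dvd_rfl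
    · simp
    · intro u v _ _ hu hv
      rw [Prod.fst_add, Prod.snd_add, add_add_add_comm]
      exact dvd_add hu hv
  · rintro y z ⟨hy, hz, ⟨⟨s, hs, rfl⟩, hne⟩, hcov⟩
    obtain rfl | ⟨g, hg, t, ht, rfl⟩ := SmonH_eq_zero_or_exists_generator_add hs
    · exact absurd (add_zero y).symm hne
    have hgd := add_snd_eq_of_generator han hmono hg
    have hgS : g ∈ SmonH n d a := AddSubmonoid.subset_closure hg
    rw [← add_assoc] at hz hcov ⊢
    have hw := mem_AperyP_of_add_mem (add_mem hy.1 hgS) ht hz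
    have hyw : y ≠ y + g := by
      intro h
      rw [left_eq_add] at h
      subst h
      exact hd.ne hgd
    have hwz : y + g = y + g + t := by
      by_contra h
      exact hcov ⟨y + g, hw, ⟨⟨g, hgS, rfl⟩, hyw⟩, ⟨t, ht, rfl⟩, h⟩
    rw [← hwz, Prod.fst_add, Prod.snd_add, add_add_add_comm, hgd, Nat.add_div_right _ hd]
end

section
/- Proposition 2.3: There exists a poset isomorphism between (Ap_1, ≤_1) and (AP_S, ≤_S) if and only if all three of the following hold: (i) AP_S has exactly d elements (the combinatorial form of the projective curve being arithmetically Cohen–Macaulay), (ii) the poset (Ap_1, ≤_1) is graded, and (iii) {a_1, …, a_{n−1}} ⊆ MSG(S_1). -/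
/-- `x` is a sum of exactly `k` of the numbers `a 1, …, a n`, with repetition allowed. -/
def HasRep (n : ℕ) (a : ℕ → ℕ) (k x : ℕ) : Prop :=
  ∃ m : Multiset ℕ, (∀ i ∈ m, 1 ≤ i ∧ i ≤ n) ∧ m.card = k ∧ (m.map a).sum = x

/-- The least number of generators among `a 1, …, a n` with sum `x`. -/
noncomputable def minLength (n : ℕ) (a : ℕ → ℕ) (x : ℕ) : ℕ :=
  sInf {k | HasRep n a k x}

/-- The lift of `x` to the plane that is homogeneous of degree `minLength n a x`. -/
noncomputable def homLift (n d : ℕ) (a : ℕ → ℕ) (x : ℕ) : ℕ × ℕ :=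
  (x, minLength n a x * d - x)

section Representations

variable {n d : ℕ} {a : ℕ → ℕ}

theorem hasRep_zero : HasRep n a 0 0 := ⟨0, by simp, by simp, by simp⟩

theorem hasRep_generator {i : ℕ} (h1 : 1 ≤ i) (hi : i ≤ n) : HasRep n a 1 (a i) :=
  ⟨{i}, by simp [h1, hi], by simp, by simp⟩

theorem HasRep.add {k l x y : ℕ} (hx : HasRep n a k x) (hy : HasRep n a l y) :
    HasRep n a (k + l) (x + y) := by
  obtain ⟨m, hm, rfl, rfl⟩ := hx
  obtain ⟨m', hm', rfl, rfl⟩ := hy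
  refine ⟨m + m', fun i hi => ?_, by simp, by simp⟩
  rcases Multiset.mem_add.1 hi with h | h
  exacts [hm i h, hm' i h]

theorem generator_mem_Smon1 {i : ℕ} (h1 : 1 ≤ i) (hi : i ≤ n) : a i ∈ Smon1 n a :=
  AddSubmonoid.subset_closure ⟨i, h1, hi, rfl⟩

theorem HasRep.mem_Smon1 {k x : ℕ} (hx : HasRep n a k x) : x ∈ Smon1 n a := by
  obtain ⟨m, hm, -, rfl⟩ := hx
  refine AddSubmonoid.multiset_sum_mem _ _ fun y hy => ?_
  obtain ⟨i, hi, rfl⟩ := Multiset.mem_map.1 hy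
  exact generator_mem_Smon1 (hm i hi).1 (hm i hi).2

theorem exists_hasRep {x : ℕ} (hx : x ∈ Smon1 n a) : ∃ k, HasRep n a k x := by
  induction hx using AddSubmonoid.closure_induction with
  | mem x hx =>
    obtain ⟨i, h1, hi, rfl⟩ := hx
    exact ⟨1, hasRep_generator h1 hi⟩
  | zero => exact ⟨0, hasRep_zero⟩
  | add x y _ _ hx hy =>
    obtain ⟨k, hk⟩ := hx
    obtain ⟨l, hl⟩ := hy
    exact ⟨k + l, hk.add hl⟩

theorem hasRep_minLength {x : ℕ} (hx : x ∈ Smon1 n a) : HasRep n a (minLength n a x) x :=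
  Nat.sInf_mem (s := {k | HasRep n a k x}) (exists_hasRep hx)

theorem HasRep.minLength_le {k x : ℕ} (hx : HasRep n a k x) : minLength n a x ≤ k :=
  Nat.sInf_le hx

theorem HasRep.eq_zero {x : ℕ} (hx : HasRep n a 0 x) : x = 0 := by
  obtain ⟨m, -, hm, rfl⟩ := hx
  rw [Multiset.card_eq_zero.1 hm]
  simp

theorem one_le_minLength {x : ℕ} (hx : x ∈ Smon1 n a) (h0 : x ≠ 0) : 1 ≤ minLength n a x := by
  by_contra h
  have h1 := hasRep_minLength hx
  rw [show minLength n a x = 0 by omega] at h1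
  exact h0 h1.eq_zero

theorem HasRep.le_mul (hle : ∀ i ≤ n, a i ≤ d) {k x : ℕ} (hx : HasRep n a k x) : x ≤ k * d := by
  obtain ⟨m, hm, rfl, rfl⟩ := hx
  have h := Multiset.sum_le_card_nsmul (m.map a) d fun y hy => by
    obtain ⟨i, hi, rfl⟩ := Multiset.mem_map.1 hy
    exact hle i (hm i hi).2
  simpa using h

theorem mem_SmonH_of_hasRep (h0 : a 0 = 0) (hle : ∀ i ≤ n, a i ≤ d) {p : ℕ × ℕ} {j k : ℕ}
    (hp : HasRep n a j p.1) (hjk : j ≤ k) (hsum : p.1 + p.2 = k * d) : p ∈ SmonH n d a := by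
  have hgen : ∀ i ≤ n, (a i, d - a i) ∈ SmonH n d a := fun i hi =>
    AddSubmonoid.subset_closure ⟨i, hi, rfl⟩
  obtain ⟨m, hm, rfl, hx⟩ := hp
  have key : p = (m.map fun i => (a i, d - a i)).sum + (k - m.card) • ((0 : ℕ), d) := by
    have h1 : ∀ m : Multiset ℕ, (∀ i ∈ m, 1 ≤ i ∧ i ≤ n) →
        (m.map fun i => (a i, d - a i)).sum.1 = (m.map a).sum ∧
        (m.map a).sum + (m.map fun i => (a i, d - a i)).sum.2 = m.card * d := by
      intro m
      induction m using Multiset.induction with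
      | empty => simp
      | cons i m ih =>
        intro hm
        have hi := hle i (hm i (Multiset.mem_cons_self i m)).2
        obtain ⟨h1, h2⟩ := ih fun j hj => hm j (Multiset.mem_cons_of_mem hj)
        simp only [Multiset.map_cons, Multiset.sum_cons, Prod.fst_add, Prod.snd_add,
          Multiset.card_cons, add_mul, one_mul]
        omega
    obtain ⟨h2, h3⟩ := h1 m hm
    obtain ⟨e, rfl⟩ := Nat.exists_eq_add_of_le hjk
    rw [add_mul] at hsum
    ext
    · simp [h2, hx]
    · simp only [Nat.add_sub_cancel_left, Prod.snd_add, Prod.smul_snd, smul_eq_mul]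
      omega
  rw [key]
  refine add_mem (AddSubmonoid.multiset_sum_mem _ _ fun y hy => ?_) (nsmul_mem ?_ _)
  · obtain ⟨i, hi, rfl⟩ := Multiset.mem_map.1 hy
    exact hgen i (hm i hi).2
  · simpa [h0] using hgen 0 (Nat.zero_le n)

theorem exists_hasRep_of_mem_SmonH (h0 : a 0 = 0) (hle : ∀ i ≤ n, a i ≤ d) {p : ℕ × ℕ}
    (hp : p ∈ SmonH n d a) : ∃ j k, HasRep n a j p.1 ∧ j ≤ k ∧ p.1 + p.2 = k * d := by
  induction hp using AddSubmonoid.closure_induction with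
  | mem p hp =>
    obtain ⟨i, hi, rfl⟩ := hp
    have := hle i hi
    rcases Nat.eq_zero_or_pos i with rfl | h
    · exact ⟨0, 1, by simpa [h0] using hasRep_zero, by omega, by simp [h0]⟩
    · exact ⟨1, 1, hasRep_generator h hi, le_rfl, by dsimp only; omega⟩
  | zero => exact ⟨0, 0, hasRep_zero, le_rfl, by simp⟩
  | add p q _ _ hp hq =>
    obtain ⟨j, k, h1, h2, h3⟩ := hp
    obtain ⟨j', k', h1', h2', h3'⟩ := hq
    refine ⟨j + j', k + k', h1.add h1', by omega, ?_⟩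
    simp only [Prod.fst_add, Prod.snd_add, add_mul]
    omega

theorem mem_SmonH_iff (h0 : a 0 = 0) (hle : ∀ i ≤ n, a i ≤ d) {p : ℕ × ℕ} :
    p ∈ SmonH n d a ↔
      p.1 ∈ Smon1 n a ∧ ∃ k, minLength n a p.1 ≤ k ∧ p.1 + p.2 = k * d := by
  constructor
  · intro hp
    obtain ⟨j, k, h1, h2, h3⟩ := exists_hasRep_of_mem_SmonH h0 hle hp
    exact ⟨h1.mem_Smon1, k, h1.minLength_le.trans h2, h3⟩
  · rintro ⟨h1, k, h2, h3⟩
    exact mem_SmonH_of_hasRep h0 hle (hasRep_minLength h1) h2 h3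

theorem homLift_fst_add_snd (hle : ∀ i ≤ n, a i ≤ d) {x : ℕ} (hx : x ∈ Smon1 n a) :
    (homLift n d a x).1 + (homLift n d a x).2 = minLength n a x * d := by
  have := (hasRep_minLength hx).le_mul hle
  simp only [homLift]
  omega

theorem homLift_mem_AperyP (hd : 0 < d) (h0 : a 0 = 0) (hle : ∀ i ≤ n, a i ≤ d) {x : ℕ}
    (hx : x ∈ AperyN (Smon1 n a) d) : homLift n d a x ∈ AperyP (SmonH n d a) d := by
  have hsum := homLift_fst_add_snd hle hx.1
  refine ⟨(mem_SmonH_iff h0 hle).2 ⟨hx.1, _, le_rfl, hsum⟩, ?_, ?_⟩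
  · rintro ⟨s, hs, h⟩
    obtain ⟨-, k, hk, hk'⟩ := (mem_SmonH_iff h0 hle).1 hs
    have h1 : x = s.1 := by simpa [homLift] using congrArg Prod.fst h
    have h2 : minLength n a x * d = (k + 1) * d := by
      rw [← hsum, h, add_mul, ← hk']
      simp only [Prod.fst_add, Prod.snd_add]
      omega
    have h3 := Nat.eq_of_mul_eq_mul_right hd h2
    rw [← h1] at hk
    omega
  · rintro ⟨s, hs, h⟩
    exact hx.2 ⟨s.1, ((mem_SmonH_iff h0 hle).1 hs).1, by simpa [homLift] using congrArg Prod.fst h⟩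

theorem leN_of_leP_homLift (h0 : a 0 = 0) (hle : ∀ i ≤ n, a i ≤ d) {y z : ℕ}
    (h : leP (SmonH n d a) (homLift n d a y) (homLift n d a z)) : leN (Smon1 n a) y z := by
  obtain ⟨s, hs, h⟩ := h
  exact ⟨s.1, ((mem_SmonH_iff h0 hle).1 hs).1, by simpa [homLift] using congrArg Prod.fst h⟩

theorem leP_homLift_add_iff (hd : 0 < d) (h0 : a 0 = 0) (hle : ∀ i ≤ n, a i ≤ d) {y s : ℕ}
    (hy : y ∈ Smon1 n a) (hs : s ∈ Smon1 n a) :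
    leP (SmonH n d a) (homLift n d a y) (homLift n d a (y + s)) ↔
      minLength n a y + minLength n a s = minLength n a (y + s) := by
  have e1 := homLift_fst_add_snd hle hy
  have e2 := homLift_fst_add_snd hle (add_mem hy hs)
  have e3 := homLift_fst_add_snd hle hs
  constructor
  · rintro ⟨t, ht, h⟩
    obtain ⟨-, k, hk, hk'⟩ := (mem_SmonH_iff h0 hle).1 ht
    have h1 : s = t.1 := by simpa [homLift] using congrArg Prod.fst h
    have h2 : minLength n a (y + s) * d = (minLength n a y + k) * d := by
      rw [← e2, h, add_mul, ← hk', ← e1]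
      simp only [Prod.fst_add, Prod.snd_add]
      omega
    have h3 := Nat.eq_of_mul_eq_mul_right hd h2
    rw [← h1] at hk
    have := ((hasRep_minLength hy).add (hasRep_minLength hs)).minLength_le
    omega
  · intro h
    refine ⟨homLift n d a s, (mem_SmonH_iff h0 hle).2 ⟨hs, _, le_rfl, e3⟩, ?_⟩
    rw [← h, add_mul] at e2
    simp only [homLift] at e1 e2 e3 ⊢
    ext
    · simp
    · rw [← h, add_mul]
      simp only [Prod.snd_add]
      rw [← h, add_mul] at e2
      omega

end Representations

theorem mem_AperyN_of_add_mem_s8 {S : AddSubmonoid ℕ} {d y s : ℕ} (hy : y ∈ S) (hs : s ∈ S)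
    (h : y + s ∈ AperyN S d) : s ∈ AperyN S d := by
  refine ⟨hs, ?_⟩
  rintro ⟨t, ht, rfl⟩
  exact h.2 ⟨y + t, add_mem hy ht, by omega⟩

/-- An Apery set of a numerical semigroup is a complete residue system. -/
theorem bijOn_mod_AperyN {S : AddSubmonoid ℕ} {d N : ℕ} (hd : 0 < d) (hdS : d ∈ S)
    (hN : ∀ m ≥ N, m ∈ S) : Set.BijOn (· % d) (AperyN S d) (Set.Iio d) := by
  have aux : ∀ y z, y ∈ AperyN S d → z ∈ AperyN S d → y % d = z % d → z ≤ y := by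
    intro y z hy hz h
    by_contra! hlt
    obtain ⟨k, hk⟩ := (Nat.modEq_iff_dvd' hlt.le).1 h
    obtain _ | k := k
    · omega
    · refine hz.2 ⟨y + k * d, add_mem hy.1 (by simpa using nsmul_mem hdS k), ?_⟩
      have : d * (k + 1) = k * d + d := by ring
      omega
  refine ⟨fun y _ => Nat.mod_lt y hd, fun y hy z hz h =>
    le_antisymm (aux z y hz hy h.symm) (aux y z hy hz h), fun r hr => ?_⟩
  have hex : ∃ y, y ∈ S ∧ y % d = r := by
    refine ⟨r + N * d, hN _ ?_, ?_⟩
    · nlinarith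
    · simpa using Nat.mod_eq_of_lt hr
  classical
  refine ⟨Nat.find hex, ⟨(Nat.find_spec hex).1, ?_⟩, (Nat.find_spec hex).2⟩
  rintro ⟨s, hs, h⟩
  refine Nat.find_min hex (m := s) (by omega) ⟨hs, ?_⟩
  have := (Nat.find_spec hex).2
  rw [h] at this
  simpa using this

theorem exists_forall_ge_mem_Smon1 {n : ℕ} {a : ℕ → ℕ} (hgcd : Finset.gcd (Finset.Icc 1 n) a = 1) :
    ∃ N, ∀ m ≥ N, m ∈ Smon1 n a := by
  obtain ⟨N, hN⟩ := Nat.exists_mem_closure_of_ge {x | ∃ i, 1 ≤ i ∧ i ≤ n ∧ x = a i}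
  refine ⟨N, fun m hm => hN m hm ?_⟩
  have h : Nat.setGcd {x | ∃ i, 1 ≤ i ∧ i ≤ n ∧ x = a i} ∣ Finset.gcd (Finset.Icc 1 n) a := by
    refine Finset.dvd_gcd fun i hi => ?_
    obtain ⟨h1, hi⟩ := Finset.mem_Icc.1 hi
    exact Nat.setGcd_dvd_of_mem ⟨i, h1, hi, rfl⟩
  rw [hgcd] at h
  exact h.trans (one_dvd m)

/-- If finite sets `A` and `B` with relations `r` and `s` are isomorphic via `φ`, then every
bijection `ψ` from `A` to `B` that reflects the relations also preserves them. -/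
theorem rel_of_bijOn_of_reflects {α β : Type*} {A : Set α} {B : Set β} (hA : A.Finite)
    {r : α → α → Prop} {s : β → β → Prop} {φ ψ : α → β} (hφ : Set.BijOn φ A B)
    (hφr : ∀ y ∈ A, ∀ z ∈ A, (r y z ↔ s (φ y) (φ z))) (hψ : Set.BijOn ψ A B)
    (hψr : ∀ y ∈ A, ∀ z ∈ A, s (ψ y) (ψ z) → r y z) {y z : α} (hy : y ∈ A) (hz : z ∈ A)
    (h : r y z) : s (ψ y) (ψ z) := by
  let R : Set (α × α) := {p | p.1 ∈ A ∧ p.2 ∈ A ∧ r p.1 p.2}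
  let T : Set (β × β) := {p | p.1 ∈ B ∧ p.2 ∈ B ∧ s p.1 p.2}
  have hR : R.Finite := (hA.prod hA).subset fun p hp => ⟨hp.1, hp.2.1⟩
  have hinj : ∀ χ : α → β, Set.InjOn χ A → Set.InjOn (Prod.map χ χ) R := by
    rintro χ hχ ⟨p, q⟩ hp ⟨p', q'⟩ hp' h
    simp only [Prod.map_apply, Prod.mk.injEq] at h
    exact Prod.ext (hχ hp.1 hp'.1 h.1) (hχ hp.2.1 hp'.2.1 h.2)
  have hTφ : Prod.map φ φ '' R = T := by
    ext ⟨p, q⟩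
    constructor
    · rintro ⟨⟨u, v⟩, ⟨hu, hv, huv⟩, h⟩
      simp only [Prod.map_apply, Prod.mk.injEq] at h
      obtain ⟨rfl, rfl⟩ := h
      exact ⟨hφ.mapsTo hu, hφ.mapsTo hv, (hφr u hu v hv).1 huv⟩
    · rintro ⟨hp, hq, hpq⟩
      obtain ⟨u, hu, rfl⟩ := hφ.surjOn hp
      obtain ⟨v, hv, rfl⟩ := hφ.surjOn hq
      exact ⟨(u, v), ⟨hu, hv, (hφr u hu v hv).2 hpq⟩, rfl⟩
  have hTψ : T ⊆ Prod.map ψ ψ '' R := by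
    rintro ⟨p, q⟩ ⟨hp, hq, hpq⟩
    obtain ⟨u, hu, rfl⟩ := hψ.surjOn hp
    obtain ⟨v, hv, rfl⟩ := hψ.surjOn hq
    exact ⟨(u, v), ⟨hu, hv, hψr u hu v hv hpq⟩, rfl⟩
  have hcard : (Prod.map ψ ψ '' R).ncard ≤ T.ncard := by
    rw [← hTφ, (hinj φ hφ.injOn).ncard_image,
      (hinj ψ hψ.injOn).ncard_image]
  have heq := Set.eq_of_subset_of_ncard_le hTψ hcard (hR.image _)
  have hmem : (ψ y, ψ z) ∈ T := heq ▸ ⟨(y, z), ⟨hy, hz, h⟩, rfl⟩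
  exact hmem.2.2

section Grading

variable {n d : ℕ} {a : ℕ → ℕ}

theorem coversN_add_of_mem_MSG {S : AddSubmonoid ℕ} {x g : ℕ} (hx : x ∈ AperyN S d)
    (hxg : x + g ∈ AperyN S d) (hg : g ∈ MSG S) : coversN S d x (x + g) := by
  obtain ⟨hgS, hg0, hg⟩ := hg
  refine ⟨hx, hxg, ⟨⟨g, hgS, rfl⟩, by omega⟩, ?_⟩
  rintro ⟨w, -, ⟨⟨u, hu, rfl⟩, hu0⟩, ⟨v, hv, h⟩, hv0⟩
  exact hg ⟨u, v, hu, hv, by omega, by omega, by omega⟩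

theorem rank_eq_add_of_hasRep (han : a n = d)
    (hmsg : ∀ i, 1 ≤ i → i ≤ n - 1 → a i ∈ MSG (Smon1 n a)) {ρ : ℕ → ℕ}
    (hρ : ∀ y z, coversN (Smon1 n a) d y z → ρ z = ρ y + 1) {k x : ℕ} (hx : HasRep n a k x)
    (hxA : x ∈ AperyN (Smon1 n a) d) : ρ x = ρ 0 + k := by
  obtain ⟨m, hm, rfl, rfl⟩ := hx
  induction m using Multiset.induction with
  | empty => simp
  | cons i m ih =>
    have hm' : ∀ j ∈ m, 1 ≤ j ∧ j ≤ n := fun j hj => hm j (Multiset.mem_cons_of_mem hj)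
    obtain ⟨h1, hi⟩ := hm i (Multiset.mem_cons_self i m)
    rw [Multiset.map_cons, Multiset.sum_cons] at hxA ⊢
    have hiS : a i ∈ Smon1 n a := generator_mem_Smon1 h1 hi
    have hmS : (m.map a).sum ∈ Smon1 n a := HasRep.mem_Smon1 ⟨m, hm', rfl, rfl⟩
    have hmA := mem_AperyN_of_add_mem_s8 hiS hmS hxA
    have hin : i ≠ n := by
      rintro rfl
      exact hxA.2 ⟨_, hmS, by rw [han, add_comm]⟩
    rw [add_comm] at hxA ⊢
    rw [hρ _ _ (coversN_add_of_mem_MSG hmA hxA (hmsg i h1 (by omega))), ih hm' hmA,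
      Multiset.card_cons, add_assoc]

theorem minLength_add_of_gradedN (han : a n = d)
    (hmsg : ∀ i, 1 ≤ i → i ≤ n - 1 → a i ∈ MSG (Smon1 n a)) (hgr : gradedN (Smon1 n a) d)
    {y s : ℕ} (hy : y ∈ Smon1 n a) (hs : s ∈ Smon1 n a) (h : y + s ∈ AperyN (Smon1 n a) d) :
    minLength n a y + minLength n a s = minLength n a (y + s) := by
  obtain ⟨ρ, hρ⟩ := hgr
  have h1 := rank_eq_add_of_hasRep han hmsg hρ ((hasRep_minLength hy).add (hasRep_minLength hs)) h
  have h2 := rank_eq_add_of_hasRep han hmsg hρ (hasRep_minLength h.1) h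
  omega

theorem gradedN_of_minLength_add (hpos : ∀ i, 1 ≤ i → i ≤ n → 0 < a i)
    (hadd : ∀ y ∈ Smon1 n a, ∀ s ∈ Smon1 n a, y + s ∈ AperyN (Smon1 n a) d →
      minLength n a y + minLength n a s = minLength n a (y + s)) :
    gradedN (Smon1 n a) d := by
  refine ⟨minLength n a, ?_⟩
  rintro y _ ⟨hy, hz, ⟨⟨s, hs, rfl⟩, hne⟩, hcov⟩
  rw [← hadd y hy.1 s hs hz]
  have hs1 : HasRep n a 1 s := by
    obtain ⟨m, hm, -, rfl⟩ := hasRep_minLength hs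
    induction m using Multiset.induction with
    | empty => simp at hne
    | cons i m _ =>
      have hm' : ∀ j ∈ m, 1 ≤ j ∧ j ≤ n := fun j hj => hm j (Multiset.mem_cons_of_mem hj)
      obtain ⟨h1, hi⟩ := hm i (Multiset.mem_cons_self i m)
      rw [Multiset.map_cons, Multiset.sum_cons] at *
      have hiS : a i ∈ Smon1 n a := generator_mem_Smon1 h1 hi
      have hmS : (m.map a).sum ∈ Smon1 n a := HasRep.mem_Smon1 ⟨m, hm', rfl, rfl⟩
      by_cases hz0 : (m.map a).sum = 0
      · rw [hz0, add_zero]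
        exact hasRep_generator h1 hi
      have hi0 := hpos i h1 hi
      refine absurd ⟨y + a i, ?_, ⟨⟨a i, hiS, rfl⟩, by omega⟩, ⟨_, hmS, by omega⟩, by omega⟩ hcov
      refine mem_AperyN_of_add_mem_s8 hmS (add_mem hy.1 hiS) ?_
      rwa [show (m.map a).sum + (y + a i) = y + (a i + (m.map a).sum) by omega]
  have := hs1.minLength_le
  have := one_le_minLength hs (by omega)
  omega

theorem mem_MSG_of_minLength_add
    (hadd : ∀ y ∈ Smon1 n a, ∀ s ∈ Smon1 n a, y + s ∈ AperyN (Smon1 n a) d →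
      minLength n a y + minLength n a s = minLength n a (y + s)) {i : ℕ} (h1 : 1 ≤ i) (hi : i ≤ n)
    (hpos : 0 < a i) (hlt : a i < d) : a i ∈ MSG (Smon1 n a) := by
  have hiS : a i ∈ Smon1 n a := generator_mem_Smon1 h1 hi
  refine ⟨hiS, hpos.ne', ?_⟩
  rintro ⟨u, v, hu, hv, hu0, hv0, h⟩
  have hA : u + v ∈ AperyN (Smon1 n a) d := h ▸ ⟨hiS, by rintro ⟨s, -, hs⟩; omega⟩
  have h2 := hadd u hu v hv hA
  have h3 := (hasRep_generator (a := a) h1 hi).minLength_le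
  have h4 := one_le_minLength hu hu0
  have h5 := one_le_minLength hv hv0
  rw [h] at h3
  omega

end Grading

/-- Proposition 2.3: `(Ap₁, ≤₁)` and `(AP_S, ≤_S)` are isomorphic posets iff `AP_S` has
exactly `d` elements (the Cohen–Macaulay criterion), `(Ap₁, ≤₁)` is graded, and
`{a 1, …, a (n-1)}` is contained in the minimal system of generators of `S₁`. -/
theorem stmt8 (n d : ℕ) (a : ℕ → ℕ) (hd : 0 < d) (hn : 2 ≤ n)
    (h0 : a 0 = 0) (han : a n = d)
    (hmono : ∀ i j, i < j → j ≤ n → a i < a j)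
    (hgcd : Finset.gcd (Finset.Icc 1 n) a = 1) :
    (∃ φ : ℕ → ℕ × ℕ,
      Set.BijOn φ (AperyN (Smon1 n a) d) (AperyP (SmonH n d a) d) ∧
      ∀ y ∈ AperyN (Smon1 n a) d, ∀ z ∈ AperyN (Smon1 n a) d,
        (leN (Smon1 n a) y z ↔ leP (SmonH n d a) (φ y) (φ z)))
    ↔
    ((AperyP (SmonH n d a) d).ncard = d ∧
      gradedN (Smon1 n a) d ∧
      ∀ i, 1 ≤ i → i ≤ n - 1 → a i ∈ MSG (Smon1 n a)) := by
  have hle : ∀ i ≤ n, a i ≤ d := fun i hi => by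
    rcases hi.lt_or_eq with h | rfl
    · exact han ▸ (hmono i n h le_rfl).le
    · exact han.le
  have hpos : ∀ i, 1 ≤ i → i ≤ n → 0 < a i := fun i h1 hi => h0 ▸ hmono 0 i h1 hi
  have hlt : ∀ i < n, a i < d := fun i hi => han ▸ hmono i n hi le_rfl
  obtain ⟨N, hN⟩ := exists_forall_ge_mem_Smon1 hgcd
  have hdS : d ∈ Smon1 n a := han ▸ generator_mem_Smon1 (by omega) le_rfl
  have hmod := bijOn_mod_AperyN hd hdS hN
  have hfin : (AperyN (Smon1 n a) d).Finite := hmod.finite_iff_finite.2 (Set.finite_Iio d)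
  have hcard : (AperyN (Smon1 n a) d).ncard = d := by simp [hmod.ncard_eq]
  have hlift : (AperyP (SmonH n d a) d).ncard = d →
      Set.BijOn (homLift n d a) (AperyN (Smon1 n a) d) (AperyP (SmonH n d a) d) := by
    intro h
    have hinj : Set.InjOn (homLift n d a) (AperyN (Smon1 n a) d) :=
      fun y _ z _ h => congrArg Prod.fst h
    have hsub : homLift n d a '' AperyN (Smon1 n a) d ⊆ AperyP (SmonH n d a) d := by
      rintro _ ⟨x, hx, rfl⟩
      exact homLift_mem_AperyP hd h0 hle hx
    have heq := Set.eq_of_subset_of_ncard_le hsub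
      (by rw [hinj.ncard_image, h, hcard]) (Set.finite_of_ncard_pos (by omega))
    exact heq ▸ hinj.bijOn_image
  constructor
  · rintro ⟨φ, hφ, hφr⟩
    have hB : (AperyP (SmonH n d a) d).ncard = d := by rw [← hφ.ncard_eq, hcard]
    have hadd : ∀ y ∈ Smon1 n a, ∀ s ∈ Smon1 n a, y + s ∈ AperyN (Smon1 n a) d →
        minLength n a y + minLength n a s = minLength n a (y + s) := fun y hy s hs h =>
      (leP_homLift_add_iff hd h0 hle hy hs).1 <|
        rel_of_bijOn_of_reflects hfin hφ hφr (hlift hB)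
          (fun _ _ _ _ => leN_of_leP_homLift h0 hle)
          (mem_AperyN_of_add_mem_s8 hs hy (add_comm y s ▸ h)) h ⟨s, hs, rfl⟩
    exact ⟨hB, gradedN_of_minLength_add hpos hadd, fun i h1 hi =>
      mem_MSG_of_minLength_add hadd h1 (by omega) (hpos i h1 (by omega)) (hlt i (by omega))⟩
  · rintro ⟨hB, hgr, hmsg⟩
    refine ⟨homLift n d a, hlift hB, fun y hy z hz => ⟨?_, leN_of_leP_homLift h0 hle⟩⟩
    rintro ⟨s, hs, rfl⟩
    exact (leP_homLift_add_iff hd h0 hle hy.1 hs).2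
      (minLength_add_of_gradedN han hmsg hgr hy.1 hs hz)
end

section
/- Proposition 2.7: Let a_1 and e be positive integers with gcd(a_1, e) = 1, let n ≥ 2, and set a_i := a_1 + (i − 1)e for i = 1, …, n and d := a_n. Then the posets (AP_S, ≤_S) and (Ap_1, ≤_1) are isomorphic if and only if a_1 > n − 2. -/
/-- If `φ` and `ψ` are bijections between finite sets with relations, `φ` preserves and reflects
the relations and `ψ` preserves them, then `ψ` reflects them too. -/
theorem reflects_of_bijOn_of_preserves {α β : Type*} {A : Set α} {B : Set β} (hB : B.Finite)
    {r : α → α → Prop} {q : β → β → Prop} {φ ψ : α → β}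
    (hφ : Set.BijOn φ A B) (hψ : Set.BijOn ψ A B)
    (hφr : ∀ y ∈ A, ∀ z ∈ A, (r y z ↔ q (φ y) (φ z)))
    (hψr : ∀ y ∈ A, ∀ z ∈ A, r y z → q (ψ y) (ψ z)) :
    ∀ y ∈ A, ∀ z ∈ A, q (ψ y) (ψ z) → r y z := by
  set R : Set (α × α) := {p | p.1 ∈ A ∧ p.2 ∈ A ∧ r p.1 p.2}
  set Q : Set (β × β) := {p | p.1 ∈ B ∧ p.2 ∈ B ∧ q p.1 p.2}
  have hQ : Q.Finite := (hB.prod hB).subset fun p hp => ⟨hp.1, hp.2.1⟩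
  have inj : ∀ {f : α → β}, Set.InjOn f A → Set.InjOn (Prod.map f f) R := by
    intro f hf x hx y hy hxy
    simp only [Prod.map, Prod.mk.injEq] at hxy
    exact Prod.ext (hf hx.1 hy.1 hxy.1) (hf hx.2.1 hy.2.1 hxy.2)
  have hφQ : Prod.map φ φ '' R = Q := by
    ext ⟨u, v⟩
    constructor
    · rintro ⟨⟨y, z⟩, ⟨hy, hz, h⟩, hyz⟩
      rw [← hyz]
      exact ⟨hφ.mapsTo hy, hφ.mapsTo hz, (hφr y hy z hz).1 h⟩
    · rintro ⟨hu, hv, h⟩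
      obtain ⟨y, hy, rfl⟩ := hφ.surjOn hu
      obtain ⟨z, hz, rfl⟩ := hφ.surjOn hv
      exact ⟨(y, z), ⟨hy, hz, (hφr y hy z hz).2 h⟩, rfl⟩
  have hψQ : Prod.map ψ ψ '' R ⊆ Q := by
    rintro _ ⟨⟨y, z⟩, ⟨hy, hz, h⟩, rfl⟩
    exact ⟨hψ.mapsTo hy, hψ.mapsTo hz, hψr y hy z hz h⟩
  have heq : Prod.map ψ ψ '' R = Q := by
    refine Set.eq_of_subset_of_ncard_le hψQ ?_ hQ
    rw [(inj hψ.injOn).ncard_image, ← hφQ, (inj hφ.injOn).ncard_image]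
  intro y hy z hz h
  have : (ψ y, ψ z) ∈ Prod.map ψ ψ '' R := by
    rw [heq]
    exact ⟨hψ.mapsTo hy, hψ.mapsTo hz, h⟩
  obtain ⟨⟨y', z'⟩, ⟨hy', hz', h'⟩, hyz⟩ := this
  simp only [Prod.map, Prod.mk.injEq] at hyz
  rwa [← hψ.injOn hy' hy hyz.1, ← hψ.injOn hz' hz hyz.2]

section ArithmeticSequence

variable {a1 e N d : ℕ} {a : ℕ → ℕ}

theorem term_add_mul (ha : ∀ i, a i = if i = 0 then 0 else a1 + (i - 1) * e)
    (hd : d = a1 + N * e) {s : ℕ} (hs : s ≤ N) : a (N + 1 - s) + s * e = d := by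
  rw [ha, if_neg (by omega), hd, add_assoc, ← add_mul]
  congr 2
  omega

theorem mul_le_mul_of_le_mul (hd : d = a1 + N * e) {m s : ℕ} (hs : s ≤ m * N) :
    s * e ≤ m * d := by
  rw [hd]
  nlinarith [Nat.mul_le_mul_right e hs, Nat.zero_le (m * a1)]

theorem mem_Smon1_iff (ha : ∀ i, a i = if i = 0 then 0 else a1 + (i - 1) * e)
    (hd : d = a1 + N * e) (x : ℕ) :
    x ∈ Smon1 (N + 1) a ↔ ∃ m s, s ≤ m * N ∧ x + s * e = m * d := by
  constructor
  · intro hx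
    induction hx using AddSubmonoid.closure_induction with
    | mem x hx =>
      obtain ⟨i, h1, h2, rfl⟩ := hx
      have h := term_add_mul ha hd (s := N + 1 - i) (by omega)
      rw [Nat.sub_sub_self h2] at h
      exact ⟨1, N + 1 - i, by omega, by rw [one_mul, h]⟩
    | zero => exact ⟨0, 0, by simp, by simp⟩
    | add x y _ _ hx hy =>
      obtain ⟨m, s, h1, h2⟩ := hx
      obtain ⟨m', s', h1', h2'⟩ := hy
      exact ⟨m + m', s + s', by linarith, by linarith⟩
  · rintro ⟨m, s, hs, h⟩
    induction m generalizing x s with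
    | zero =>
      obtain rfl : x = 0 := by rw [zero_mul] at h; omega
      exact zero_mem _
    | succ m ih =>
      obtain ⟨u, v, rfl, hu, hv⟩ : ∃ u v, s = u + v ∧ u ≤ N ∧ v ≤ m * N :=
        ⟨min s N, s - min s N, by omega, by omega, by rw [add_mul] at hs; omega⟩
      have hg := term_add_mul ha hd hu
      have hvd := mul_le_mul_of_le_mul hd hv
      have hx : x = a (N + 1 - u) + (m * d - v * e) := by
        zify [hvd] at *
        linarith
      rw [hx]
      refine add_mem (AddSubmonoid.subset_closure ⟨N + 1 - u, by omega, by omega, rfl⟩)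
        (ih _ v hv (by omega))

theorem mem_SmonH_iff_s9 (ha : ∀ i, a i = if i = 0 then 0 else a1 + (i - 1) * e)
    (hd : d = a1 + N * e) (p : ℕ × ℕ) :
    p ∈ SmonH (N + 1) d a ↔
      ∃ l m s, s ≤ m * N ∧ p.1 + s * e = m * d ∧ p.2 = l * d + s * e := by
  have h0 : ((0 : ℕ), d) ∈ SmonH (N + 1) d a :=
    AddSubmonoid.subset_closure ⟨0, by omega, by simp [ha]⟩
  constructor
  · intro hx
    induction hx using AddSubmonoid.closure_induction with
    | mem x hx =>
      obtain ⟨i, h2, rfl⟩ := hx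
      rcases Nat.eq_zero_or_pos i with rfl | h1
      · exact ⟨1, 0, 0, by simp, by simp [ha], by simp [ha]⟩
      have h := term_add_mul ha hd (s := N + 1 - i) (by omega)
      rw [Nat.sub_sub_self h2] at h
      refine ⟨0, 1, N + 1 - i, by omega, by rw [one_mul, h], ?_⟩
      simp only
      omega
    | zero => exact ⟨0, 0, 0, by simp, by simp, by simp⟩
    | add x y _ _ hx hy =>
      obtain ⟨l, m, s, h1, h2, h3⟩ := hx
      obtain ⟨l', m', s', h1', h2', h3'⟩ := hy
      refine ⟨l + l', m + m', s + s', by linarith, ?_, ?_⟩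
      · rw [Prod.fst_add]; linarith
      · rw [Prod.snd_add]; linarith
  · rintro ⟨l, m, s, hs, h, h'⟩
    suffices hmain : ∀ x, x + s * e = m * d → (x, s * e) ∈ SmonH (N + 1) d a by
      have : p = l • ((0 : ℕ), d) + (p.1, s * e) := by
        ext <;> simp [h']
      rw [this]
      exact add_mem (nsmul_mem h0 l) (hmain _ h)
    clear h h' p
    intro x h
    induction m generalizing x s with
    | zero =>
      obtain rfl : s = 0 := by omega
      obtain rfl : x = 0 := by omega
      rw [zero_mul]
      exact zero_mem _
    | succ m ih =>
      obtain ⟨u, v, rfl, hu, hv⟩ : ∃ u v, s = u + v ∧ u ≤ N ∧ v ≤ m * N :=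
        ⟨min s N, s - min s N, by omega, by omega, by rw [add_mul] at hs; omega⟩
      have hg := term_add_mul ha hd hu
      have hvd := mul_le_mul_of_le_mul hd hv
      have hx : (x, (u + v) * e) =
          (a (N + 1 - u), d - a (N + 1 - u)) + (m * d - v * e, v * e) := by
        have : d - a (N + 1 - u) = u * e := by omega
        rw [this, Prod.mk_add_mk, add_mul]
        congr 1
        zify [hvd] at *
        linarith
      rw [hx]
      exact add_mem (AddSubmonoid.subset_closure ⟨N + 1 - u, by omega, rfl⟩)
        (ih v hv _ (by omega))

theorem exists_shift (hd : d = a1 + N * e) (ha1 : 0 < a1) (hgcd : Nat.gcd a1 e = 1)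
    {m s m' s' : ℤ} (hs : s < d) (hs' : 0 ≤ s') (hm' : s' ≤ m' * N)
    (h : m * d - s * e = m' * d - s' * e) :
    ∃ j : ℤ, 0 ≤ j ∧ s' = s + j * d ∧ s + j * a1 ≤ m * N := by
  have hd0 : (0 : ℤ) < d := by rw [hd]; positivity
  have hcop : IsCoprime (d : ℤ) e := by
    rw [Nat.isCoprime_iff_coprime, hd]
    simpa [Nat.Coprime] using hgcd
  have hdvd : (d : ℤ) ∣ (s' - s) * e := ⟨m' - m, by linarith⟩
  obtain ⟨j, hj⟩ := hcop.dvd_of_dvd_mul_right hdvd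
  have hm : m' = m + j * e := by
    have : (d : ℤ) * (m' - m) = d * (j * e) := by
      calc (d : ℤ) * (m' - m) = (s' - s) * e := by linarith
        _ = d * (j * e) := by rw [hj]; ring
    linarith [mul_left_cancel₀ hd0.ne' this]
  have hdz : (d : ℤ) = a1 + N * e := by exact_mod_cast hd
  refine ⟨j, ?_, by linarith, ?_⟩
  · by_contra! hneg
    nlinarith
  · have : s' = s + j * (a1 + N * e) := by rw [← hdz]; linarith
    rw [hm, this] at hm'
    linarith

theorem mem_AperyN_iff (ha : ∀ i, a i = if i = 0 then 0 else a1 + (i - 1) * e)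
    (hd : d = a1 + N * e) (ha1 : 0 < a1) (hN : 0 < N)
    (hgcd : Nat.gcd a1 e = 1) (y : ℕ) :
    y ∈ AperyN (Smon1 (N + 1) a) d ↔
      ∃ s c, s < d ∧ s ≤ c * N ∧ c * N < s + N ∧ y + s * e = c * d := by
  have hd0 : 0 < d := by omega
  constructor
  · rintro ⟨hy, hmin⟩
    rw [mem_Smon1_iff ha hd] at hy
    obtain ⟨m, s, hs, h⟩ := hy
    obtain ⟨r, j, hr, rfl⟩ : ∃ r j, r < d ∧ s = r + j * d :=
      ⟨s % d, s / d, Nat.mod_lt _ hd0, by rw [mul_comm, Nat.mod_add_div]⟩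
    obtain ⟨c, rfl⟩ : ∃ c, m = c + j * e := by
      refine ⟨m - j * e, ?_⟩
      have : j * e ≤ m := by
        refine le_of_mul_le_mul_right (a := d) ?_ hd0
        rw [← h]
        nlinarith [Nat.zero_le (r * e)]
      omega
    have hrc : r ≤ c * N := by
      have : j * (N * e) ≤ j * d := Nat.mul_le_mul_left _ (by omega)
      nlinarith
    have hyr : y + r * e = c * d := by linarith
    refine ⟨r, c, hr, hrc, ?_, hyr⟩
    by_contra! hcon
    rcases c with _ | c
    · omega
    have hrc' : r ≤ c * N := by linarith
    have hrd := mul_le_mul_of_le_mul hd hrc'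
    refine hmin ⟨y - d, (mem_Smon1_iff ha hd _).2 ⟨c, r, hrc', ?_⟩, ?_⟩ <;>
      rw [add_mul] at hyr <;> omega
  · rintro ⟨s, c, hs, hsc, hcs, h⟩
    refine ⟨(mem_Smon1_iff ha hd y).2 ⟨c, s, hsc, h⟩, ?_⟩
    rintro ⟨z, hz, rfl⟩
    obtain ⟨m, s', hs', h'⟩ := (mem_Smon1_iff ha hd z).1 hz
    zify at h h' hs' hs hcs
    obtain ⟨j, hj, -, hle⟩ := exists_shift (m := c - 1) (s := s) (m' := m) (s' := s') hd ha1 hgcd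
      hs (by positivity) hs' (by linarith)
    have : 0 ≤ j * a1 := by positivity
    linarith

theorem finite_AperyN (ha : ∀ i, a i = if i = 0 then 0 else a1 + (i - 1) * e)
    (hd : d = a1 + N * e) (ha1 : 0 < a1) (hN : 0 < N) (hgcd : Nat.gcd a1 e = 1) :
    (AperyN (Smon1 (N + 1) a) d).Finite := by
  refine (Set.finite_Iic ((d + N) * d)).subset fun y hy => ?_
  obtain ⟨s, c, hs, -, hcs, h⟩ := (mem_AperyN_iff ha hd ha1 hN hgcd y).1 hy
  have hc : c ≤ d + N := by nlinarith
  have := Nat.mul_le_mul_right d hc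
  simp only [Set.mem_Iic]
  omega

theorem mem_AperyP_iff (ha : ∀ i, a i = if i = 0 then 0 else a1 + (i - 1) * e)
    (hd : d = a1 + N * e) (ha1 : 0 < a1) (he : 0 < e) (hN : 0 < N)
    (hgcd : Nat.gcd a1 e = 1) (p : ℕ × ℕ) :
    p ∈ AperyP (SmonH (N + 1) d a) d ↔
      ∃ s c, s < d ∧ s ≤ c * N ∧ c * N < s + N ∧ p.1 + s * e = c * d ∧ p.2 = s * e := by
  constructor
  · rintro ⟨hp, hmin, hmin'⟩
    have hl : ∀ l m s, s ≤ m * N → p.1 + s * e = m * d → p.2 = l * d + s * e → l = 0 := by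
      intro l m s hs h1 h2
      rcases l with _ | l
      · rfl
      refine absurd ⟨(p.1, l * d + s * e), (mem_SmonH_iff_s9 ha hd _).2 ⟨l, m, s, hs, h1, rfl⟩, ?_⟩
        hmin
      ext
      · simp
      · simp only [Prod.snd_add]
        linarith
    obtain ⟨l, m, s, hs, h1, h2⟩ := (mem_SmonH_iff_s9 ha hd p).1 hp
    obtain rfl := hl l m s hs h1 h2
    rw [zero_mul, zero_add] at h2
    have hsd : s < d := by
      by_contra! hcon
      obtain ⟨t, rfl⟩ := Nat.exists_eq_add_of_le hcon
      have hem : e ≤ m := by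
        by_contra! hlt
        nlinarith
      obtain ⟨k, rfl⟩ := Nat.exists_eq_add_of_le hem
      exact he.ne' (hl e k t (by linarith) (by linarith) (by linarith))
    refine ⟨s, m, hsd, hs, ?_, h1, h2⟩
    by_contra! hcon
    rcases m with _ | c
    · omega
    have hsc : s ≤ c * N := by linarith
    have hrd := mul_le_mul_of_le_mul hd hsc
    rw [add_mul, one_mul] at h1
    refine hmin' ⟨(p.1 - d, p.2), (mem_SmonH_iff_s9 ha hd _).2 ⟨0, c, s, hsc, ?_, ?_⟩, ?_⟩
    · simp only
      omega
    · simp [h2]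
    · ext
      · simp only [Prod.fst_add]
        omega
      · simp
  · rintro ⟨s, c, hs, hsc, hcs, h1, h2⟩
    refine ⟨(mem_SmonH_iff_s9 ha hd p).2 ⟨0, c, s, hsc, h1, by simp [h2]⟩, ?_, ?_⟩
    · rintro ⟨z, hz, rfl⟩
      obtain ⟨l, m, s', hs', h1', h2'⟩ := (mem_SmonH_iff_s9 ha hd z).1 hz
      simp only [Prod.fst_add, Prod.snd_add, add_zero] at h1 h2
      zify at h1 h2 h1' h2' hs' hs hcs
      obtain ⟨j, hj, hss, -⟩ := exists_shift (m := c) (s := s) (m' := m) (s' := s') hd ha1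
        hgcd hs (by positivity) hs' (by linarith)
      have : 0 ≤ j * d * e := by positivity
      have : 0 ≤ (l : ℤ) * d := by positivity
      have : (0 : ℤ) < d := by omega
      have : (s' : ℤ) * e = s * e + j * d * e := by rw [hss]; ring
      linarith
    · rintro ⟨z, hz, rfl⟩
      obtain ⟨l, m, s', hs', h1', h2'⟩ := (mem_SmonH_iff_s9 ha hd z).1 hz
      simp only [Prod.fst_add, Prod.snd_add, add_zero] at h1 h2
      zify at h1 h2 h1' h2' hs' hs hcs
      obtain ⟨j, hj, -, hle⟩ := exists_shift (m := c - 1) (s := s) (m' := m) (s' := s') hd ha1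
        hgcd hs (by positivity) hs' (by linarith)
      have : 0 ≤ j * a1 := by positivity
      linarith

theorem bijOn_fst_AperyP_AperyN (ha : ∀ i, a i = if i = 0 then 0 else a1 + (i - 1) * e)
    (hd : d = a1 + N * e) (ha1 : 0 < a1) (he : 0 < e) (hN : 0 < N) (hgcd : Nat.gcd a1 e = 1) :
    Set.BijOn Prod.fst (AperyP (SmonH (N + 1) d a) d) (AperyN (Smon1 (N + 1) a) d) := by
  have key : ∀ {s c s' c' x : ℕ}, s < d → s' ≤ c' * N → x + s * e = c * d →
      x + s' * e = c' * d → s ≤ s' := by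
    intro s c s' c' x hs hsc' h h'
    zify at hs hsc' h h' ⊢
    obtain ⟨j, hj, hss, -⟩ := exists_shift (m := c) (s := s) (m' := c') (s' := s') hd ha1
      hgcd hs (by positivity) hsc' (by linarith)
    have : 0 ≤ j * d := by positivity
    linarith
  refine ⟨fun p hp => ?_, fun p hp p' hp' hpp => ?_, fun y hy => ?_⟩
  · obtain ⟨s, c, hs, hsc, hcs, h1, -⟩ := (mem_AperyP_iff ha hd ha1 he hN hgcd p).1 hp
    exact (mem_AperyN_iff ha hd ha1 hN hgcd _).2 ⟨s, c, hs, hsc, hcs, h1⟩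
  · obtain ⟨s, c, hs, hsc, hcs, h1, h2⟩ := (mem_AperyP_iff ha hd ha1 he hN hgcd p).1 hp
    obtain ⟨s', c', hs', hsc', hcs', h1', h2'⟩ := (mem_AperyP_iff ha hd ha1 he hN hgcd p').1 hp'
    rw [← hpp] at h1'
    have : s = s' := le_antisymm (key hs hsc' h1 h1') (key hs' hsc h1' h1)
    exact Prod.ext hpp (by rw [h2, h2', this])
  · obtain ⟨s, c, hs, hsc, hcs, h⟩ := (mem_AperyN_iff ha hd ha1 hN hgcd y).1 hy
    exact ⟨(y, s * e), (mem_AperyP_iff ha hd ha1 he hN hgcd _).2 ⟨s, c, hs, hsc, hcs, h, rfl⟩, rfl⟩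

theorem leN_of_leP (ha : ∀ i, a i = if i = 0 then 0 else a1 + (i - 1) * e)
    (hd : d = a1 + N * e) {y z : ℕ × ℕ} (h : leP (SmonH (N + 1) d a) y z) :
    leN (Smon1 (N + 1) a) y.1 z.1 := by
  obtain ⟨w, hw, rfl⟩ := h
  obtain ⟨-, m, s, hs, h, -⟩ := (mem_SmonH_iff_s9 ha hd w).1 hw
  exact ⟨w.1, (mem_Smon1_iff ha hd _).2 ⟨m, s, hs, h⟩, rfl⟩

theorem leP_of_leN (ha : ∀ i, a i = if i = 0 then 0 else a1 + (i - 1) * e)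
    (hd : d = a1 + N * e) (ha1 : 0 < a1) (he : 0 < e) (hN : 0 < N) (hgcd : Nat.gcd a1 e = 1)
    (hlt : N - 1 < a1) {y z : ℕ × ℕ} (hy : y ∈ AperyP (SmonH (N + 1) d a) d)
    (hz : z ∈ AperyP (SmonH (N + 1) d a) d) (h : leN (Smon1 (N + 1) a) y.1 z.1) :
    leP (SmonH (N + 1) d a) y z := by
  obtain ⟨s, c, hs, hsc, hcs, h1, h2⟩ := (mem_AperyP_iff ha hd ha1 he hN hgcd y).1 hy
  obtain ⟨t, b, ht, htb, hbt, h1', h2'⟩ := (mem_AperyP_iff ha hd ha1 he hN hgcd z).1 hz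
  obtain ⟨w, hw, hwz⟩ := h
  obtain ⟨m, u, hu, hwu⟩ := (mem_Smon1_iff ha hd w).1 hw
  rw [hwz] at h1'
  obtain ⟨j, hj, huj, hle⟩ := exists_shift (m := (b : ℤ) - c) (s := (t : ℤ) - s) (m' := m)
    (s' := u) hd ha1 hgcd (by omega) (by positivity) (by exact_mod_cast hu)
    (by zify at h1 h1' hwu; linarith)
  have hst : s ≤ t := by
    by_contra! hts
    have hj1 : 1 ≤ j := by
      by_contra! hj0
      obtain rfl : j = 0 := by omega
      omega
    have : (a1 : ℤ) ≤ j * a1 := by nlinarith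
    zify at hcs htb hbt hsc
    have : (a1 : ℤ) ≤ N - 1 := by nlinarith
    omega
  obtain ⟨r, rfl⟩ := Nat.exists_eq_add_of_le hst
  have hr : (r : ℤ) ≤ (b - c) * N := by
    have : 0 ≤ j * a1 := by positivity
    push_cast at hle
    linarith
  have hcb : c ≤ b := by
    by_contra! hbc
    zify at hbc
    nlinarith
  obtain ⟨k, rfl⟩ := Nat.exists_eq_add_of_le hcb
  refine ⟨(w, r * e), (mem_SmonH_iff_s9 ha hd _).2 ⟨0, k, r, ?_, ?_, by simp⟩, ?_⟩
  · push_cast at hr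
    zify
    linarith
  · simp only
    linarith
  · ext
    · exact hwz
    · simp only [Prod.snd_add]
      linarith

theorem exists_leN_not_leP (ha : ∀ i, a i = if i = 0 then 0 else a1 + (i - 1) * e)
    (hd : d = a1 + N * e) (ha1 : 0 < a1) (he : 0 < e) (hN : 0 < N) (hgcd : Nat.gcd a1 e = 1)
    (hle : a1 ≤ N - 1) :
    ∃ y ∈ AperyP (SmonH (N + 1) d a) d, ∃ z ∈ AperyP (SmonH (N + 1) d a) d,
      leN (Smon1 (N + 1) a) y.1 z.1 ∧ ¬ leP (SmonH (N + 1) d a) y z := by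
  obtain ⟨M, rfl⟩ : ∃ M, N = M + 1 := ⟨N - 1, by omega⟩
  have hM : M ≤ M * e := Nat.le_mul_of_pos_right M he
  have hd' : d = a1 + M * e + e := by rw [hd]; ring
  refine ⟨(a1, (M + 1) * e), (mem_AperyP_iff ha hd ha1 he hN hgcd _).2
    ⟨M + 1, 1, ?_, ?_, ?_, ?_, rfl⟩, (a1 + M * e, e), (mem_AperyP_iff ha hd ha1 he hN hgcd _).2
    ⟨1, 1, ?_, ?_, ?_, ?_, ?_⟩, ⟨M * e, (mem_Smon1_iff ha hd _).2 ⟨e, d - M, ?_, ?_⟩, rfl⟩, ?_⟩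
  · omega
  · omega
  · omega
  · rw [hd]; ring
  · omega
  · omega
  · omega
  · simp only; omega
  · simp
  · rw [mul_add, mul_comm e M]; omega
  · rw [← add_mul, Nat.add_sub_cancel' (by omega), mul_comm]
  · rintro ⟨w, -, hw⟩
    have := congrArg Prod.snd hw
    simp only [Prod.snd_add, add_mul, one_mul] at this
    omega

end ArithmeticSequence

/-- Proposition 2.7: for the arithmetic sequence `a i = a₁ + (i - 1)e`, `i = 1, …, n`,
with `gcd(a₁, e) = 1`, the posets `(AP_S, ≤_S)` and `(Ap₁, ≤₁)` are isomorphic iff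
`a₁ > n - 2`. -/
theorem stmt9 (a1 e n : ℕ) (ha1 : 0 < a1) (he : 0 < e) (hn : 2 ≤ n)
    (hgcd : Nat.gcd a1 e = 1)
    (a : ℕ → ℕ) (ha : ∀ i, a i = if i = 0 then 0 else a1 + (i - 1) * e)
    (d : ℕ) (hd : d = a1 + (n - 1) * e) :
    (∃ φ : ℕ × ℕ → ℕ,
      Set.BijOn φ (AperyP (SmonH n d a) d) (AperyN (Smon1 n a) d) ∧
      ∀ y ∈ AperyP (SmonH n d a) d, ∀ z ∈ AperyP (SmonH n d a) d,
        (leP (SmonH n d a) y z ↔ leN (Smon1 n a) (φ y) (φ z)))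
    ↔ n - 2 < a1 := by
  obtain ⟨N, rfl⟩ : ∃ N, n = N + 1 := ⟨n - 1, by omega⟩
  rw [Nat.add_sub_cancel] at hd
  have hN : 0 < N := by omega
  have hbij := bijOn_fst_AperyP_AperyN ha hd ha1 he hN hgcd
  constructor
  · rintro ⟨φ, hφ, hφr⟩
    by_contra! hle
    obtain ⟨y, hy, z, hz, hyz, hnot⟩ := exists_leN_not_leP ha hd ha1 he hN hgcd (by omega)
    exact hnot (reflects_of_bijOn_of_preserves (finite_AperyN ha hd ha1 hN hgcd) hφ hbij hφr
      (fun _ _ _ _ => leN_of_leP ha hd) y hy z hz hyz)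
  · intro hlt
    exact ⟨Prod.fst, hbij, fun y hy z hz => ⟨leN_of_leP ha hd,
      leP_of_leN ha hd ha1 he hN hgcd (by omega) hy hz⟩⟩
end

section
/- Lemma 3.1(b) (recalled from [BGGM, Lemma 2] and used in the paper): Let a_1, e be positive integers with gcd(a_1, e) = 1, let n ≥ 2, and set a_i := a_1 + (i − 1)e for i = 1, …, n and q := ⌊(a_1 − 1)/(n − 1)⌋. Then q + e + 1 = min{m ∈ ℤ : m > 0 and m·a_1 belongs to the additive submonoid of ℕ generated by {a_2, …, a_n}}. -/
/-- A sum of `k` terms `a + c * e` with `1 ≤ c ≤ n - 1` can be any `k * a + j * e` with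
`k ≤ j ≤ k * (n - 1)`. -/
theorem mul_add_mul_mem_closure_arith (a e n : ℕ) (hn : 2 ≤ n) (k : ℕ) :
    ∀ j, k ≤ j → j ≤ k * (n - 1) → k * a + j * e ∈
      AddSubmonoid.closure {x : ℕ | ∃ i, 2 ≤ i ∧ i ≤ n ∧ x = a + (i - 1) * e} := by
  obtain ⟨N, rfl⟩ : ∃ N, n = N + 2 := ⟨n - 2, by omega⟩
  induction k with
  | zero =>
    intro j _ hj
    obtain rfl : j = 0 := by simpa using hj
    simp
  | succ k ih =>
    intro j hkj hj
    simp only [Nat.add_succ_sub_one] at hj ih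
    obtain ⟨c, j', rfl, hc, hcN, hkj', hj'⟩ : ∃ c j', j = j' + c ∧ 1 ≤ c ∧ c ≤ N + 1 ∧
        k ≤ j' ∧ j' ≤ k * (N + 1) := by
      have hk : k ≤ k * (N + 1) := Nat.le_mul_of_pos_right k N.succ_pos
      rw [Nat.succ_mul] at hj
      by_cases h : j ≤ k * (N + 1) + 1
      · exact ⟨1, j - 1, by omega⟩
      · exact ⟨j - k * (N + 1), k * (N + 1), by omega⟩
    have hgen : a + c * e ∈ AddSubmonoid.closure
        {x : ℕ | ∃ i, 2 ≤ i ∧ i ≤ N + 2 ∧ x = a + (i - 1) * e} :=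
      AddSubmonoid.subset_closure ⟨c + 1, by omega, by omega, by simp⟩
    have hsum := add_mem (ih j' hkj' hj') hgen
    convert hsum using 1
    ring

theorem exists_of_mem_closure_arith (a e n x : ℕ)
    (hx : x ∈ AddSubmonoid.closure {x : ℕ | ∃ i, 2 ≤ i ∧ i ≤ n ∧ x = a + (i - 1) * e}) :
    ∃ k j, k ≤ j ∧ j ≤ k * (n - 1) ∧ x = k * a + j * e := by
  induction hx using AddSubmonoid.closure_induction with
  | mem x hx =>
    obtain ⟨i, hi, hin, rfl⟩ := hx
    exact ⟨1, i - 1, by omega, by omega, by ring⟩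
  | zero => exact ⟨0, 0, by simp⟩
  | add x y _ _ hx hy =>
    obtain ⟨k, j, hkj, hj, rfl⟩ := hx
    obtain ⟨k', j', hkj', hj', rfl⟩ := hy
    exact ⟨k + k', j + j', by omega, by rw [add_mul]; omega, by ring⟩

/-- Lemma 3.1(b) ([BGGM, Lemma 2]): for the arithmetic sequence `a_i = a₁ + (i - 1)e`
with `gcd(a₁, e) = 1` and `q = ⌊(a₁ - 1)/(n - 1)⌋`, one has
`q + e + 1 = min{m > 0 : m·a₁ ∈ ⟨a₂, …, a_n⟩}`. -/
theorem stmt10 (a1 e n : ℕ) (ha1 : 0 < a1) (he : 0 < e) (hn : 2 ≤ n)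
    (hgcd : Nat.gcd a1 e = 1) :
    IsLeast {m : ℕ | 0 < m ∧ m * a1 ∈
        AddSubmonoid.closure {x : ℕ | ∃ i, 2 ≤ i ∧ i ≤ n ∧ x = a1 + (i - 1) * e}}
      ((a1 - 1) / (n - 1) + e + 1) := by
  have hN : 0 < n - 1 := by omega
  constructor
  · refine ⟨Nat.succ_pos _, ?_⟩
    have hq : (a1 - 1) / (n - 1) ≤ a1 - 1 := Nat.div_le_self _ _
    have hlt : a1 - 1 < ((a1 - 1) / (n - 1) + 1) * (n - 1) := by
      rw [mul_comm]
      exact Nat.lt_mul_div_succ _ hN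
    have hmem := mul_add_mul_mem_closure_arith a1 e n hn ((a1 - 1) / (n - 1) + 1) a1
      (by omega) (by omega)
    convert hmem using 1
    ring
  · rintro m ⟨hm, hmem⟩
    obtain ⟨k, j, hkj, hj, heq⟩ := exists_of_mem_closure_arith a1 e n _ hmem
    have hdvd : a1 ∣ j * e :=
      (Nat.dvd_add_right (Dvd.intro_left k rfl)).mp (heq ▸ Dvd.intro_left m rfl)
    obtain ⟨t, rfl⟩ := Nat.Coprime.dvd_of_dvd_mul_right hgcd hdvd
    obtain rfl : m = k + t * e := Nat.eq_of_mul_eq_mul_right ha1 (by rw [heq]; ring)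
    have ht : 0 < t := by
      rcases Nat.eq_zero_or_pos t with rfl | ht
      · simp at hkj hm
        omega
      · exact ht
    have hat : a1 ≤ a1 * t := Nat.le_mul_of_pos_right a1 ht
    have het : e ≤ t * e := Nat.le_mul_of_pos_left e ht
    have hqk : (a1 - 1) / (n - 1) < k := (Nat.div_lt_iff_lt_mul hN).mpr (by omega)
    omega
end

section
/- Corollary 4.2 (combinatorial form): Let a_1 < ⋯ < a_n be positive integers and set M := a_n + (a_n − 1)·Σ_{i=1}^{n−1}(a_n − a_i). Then for every integer j ≥ M, the additive submonoid S of ℕ × ℕ generated by (0, j), (a_1, j − a_1), …, (a_n, j − a_n), (j, 0) satisfies: for every s ∈ ℤ × ℤ, if s + (0, j) ∈ S and s + (j, 0) ∈ S, then s ∈ S. -/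
/-- The monoid `S ⊆ ℕ × ℕ` generated by `(0, j)`, `(a 1, j - a 1), …, (a n, j - a n)`
and `(j, 0)`. -/
def SmonC (n j : ℕ) (a : ℕ → ℕ) : AddSubmonoid (ℕ × ℕ) :=
  AddSubmonoid.closure
    {p | p = ((0 : ℕ), j) ∨ p = (j, (0 : ℕ)) ∨ ∃ i, 1 ≤ i ∧ i ≤ n ∧ p = (a i, j - a i)}

/-- The image of `SmonC` inside `ℤ × ℤ`. -/
def SmonCZ (n j : ℕ) (a : ℕ → ℕ) : Set (ℤ × ℤ) :=
  {p | ∃ q ∈ SmonC n j a, p = ((q.1 : ℤ), (q.2 : ℤ))}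

/-- A multiset of at least `b` naturals has a nonempty submultiset whose sum is divisible by `b`. -/
theorem Multiset.exists_le_ne_zero_dvd_sum {b : ℕ} (hb : 0 < b) (m : Multiset ℕ)
    (hm : b ≤ m.card) : ∃ t ≤ m, t ≠ 0 ∧ b ∣ t.sum := by
  obtain ⟨l, rfl⟩ := Quot.exists_rep m
  have hl : b ≤ l.length := hm
  obtain ⟨x, hx, y, hy, hxy, he⟩ := Finset.exists_ne_map_eq_of_card_lt_of_maps_to
    (s := Finset.range (b + 1)) (t := Finset.range b) (f := fun i => (l.take i).sum % b)
    (by simp) (fun i _ => by simpa using Nat.mod_lt _ hb)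
  wlog hlt : x < y generalizing x y
  · exact this y hy x hx hxy.symm he.symm (by omega)
  have hyb : y ≤ b := by simpa [Nat.lt_succ_iff] using hy
  refine ⟨((l.take y).drop x : List ℕ), ?_, ?_, ?_⟩
  · exact Multiset.coe_le.2 (((List.drop_sublist _ _).trans (List.take_sublist _ _)).subperm)
  · intro h
    have := congrArg Multiset.card h
    simp at this
    omega
  · have hs : (l.take y).sum = (l.take x).sum + ((l.take y).drop x).sum := by
      rw [← List.sum_append]
      conv_lhs => rw [← List.take_append_drop x (l.take y), List.take_take, min_eq_left hlt.le]
    have h2 : (l.take x).sum ≡ (l.take y).sum [MOD b] := he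
    have := (Nat.modEq_iff_dvd' (by omega)).1 h2
    rw [Multiset.sum_coe]
    rwa [hs, Nat.add_sub_cancel_left] at this

/-- Membership in `SmonC` in terms of the multiset of generators used. -/
theorem mem_SmonC_iff {n j : ℕ} {a : ℕ → ℕ} (ha : ∀ i, 1 ≤ i → i ≤ n → a i ≤ j) (q : ℕ × ℕ) :
    q ∈ SmonC n j a ↔ ∃ (u k : ℕ) (m : Multiset ℕ), (∀ e ∈ m, ∃ i, 1 ≤ i ∧ i ≤ n ∧ e = a i) ∧
      q.1 = k * j + m.sum ∧ q.1 + q.2 = (u + k + m.card) * j := by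
  constructor
  · intro h
    induction h using AddSubmonoid.closure_induction with
    | mem p hp =>
      rcases hp with rfl | rfl | ⟨i, h1, h2, rfl⟩
      · exact ⟨1, 0, 0, by simp⟩
      · exact ⟨0, 1, 0, by simp⟩
      · exact ⟨0, 0, {a i}, by simpa using ⟨⟨i, h1, h2, rfl⟩, Nat.add_sub_cancel' (ha i h1 h2)⟩⟩
    | zero => exact ⟨0, 0, 0, by simp⟩
    | add p q _ _ hp hq =>
      obtain ⟨u, k, m, h1, h2, h3⟩ := hp
      obtain ⟨u', k', m', h1', h2', h3'⟩ := hq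
      refine ⟨u + u', k + k', m + m', ?_, ?_, ?_⟩
      · intro e he
        rcases Multiset.mem_add.1 he with h | h
        exacts [h1 e h, h1' e h]
      · simp only [Prod.fst_add, Multiset.sum_add]
        linarith
      · simp only [Prod.fst_add, Prod.snd_add, Multiset.card_add]
        linarith
  · rintro ⟨u, k, m, h1, h2, h3⟩
    have hu : ((0 : ℕ), j) ∈ SmonC n j a := AddSubmonoid.subset_closure (Or.inl rfl)
    have hk : (j, (0 : ℕ)) ∈ SmonC n j a := AddSubmonoid.subset_closure (Or.inr (Or.inl rfl))
    have hm : ∃ p ∈ SmonC n j a, p.1 = m.sum ∧ p.1 + p.2 = m.card * j := by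
      clear h2 h3
      induction m using Multiset.induction_on with
      | empty => exact ⟨0, zero_mem _, by simp⟩
      | cons e m ih =>
        obtain ⟨p, hp, hp1, hp2⟩ := ih fun e he => h1 e (Multiset.mem_cons_of_mem he)
        obtain ⟨i, hi1, hi2, rfl⟩ := h1 e (Multiset.mem_cons_self _ _)
        refine ⟨(a i, j - a i) + p, add_mem (AddSubmonoid.subset_closure
          (Or.inr (Or.inr ⟨i, hi1, hi2, rfl⟩))) hp, by simp [hp1], ?_⟩
        have := ha i hi1 hi2
        simp only [Prod.fst_add, Prod.snd_add, Multiset.card_cons, add_mul]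
        omega
    obtain ⟨p, hp, hp1, hp2⟩ := hm
    have hq : q = u • ((0 : ℕ), j) + k • (j, (0 : ℕ)) + p := by
      simp only [add_mul] at h3
      ext
      · simp; omega
      · simp; omega
    rw [hq]
    exact add_mem (add_mem (nsmul_mem hu u) (nsmul_mem hk k)) hp

/-- If `m` has many entries below its maximum `b`, then its sum is attained by a smaller multiset
with entries among those of `m` and `b`. -/
theorem Multiset.exists_card_lt_sum_eq {b : ℕ} (hb : 0 < b) (m : Multiset ℕ)
    (hle : ∀ e ∈ m, e ≤ b) (hm : b ≤ (m.filter (· ≠ b)).card) :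
    ∃ m' : Multiset ℕ, (∀ e ∈ m', e ∈ m ∨ e = b) ∧ m'.sum = m.sum ∧ m'.card < m.card := by
  obtain ⟨t, ht, ht0, c, hc⟩ := Multiset.exists_le_ne_zero_dvd_sum hb _ hm
  obtain ⟨r, rfl⟩ := Multiset.le_iff_exists_add.1 (ht.trans (Multiset.filter_le _ _))
  have hlt : t.sum < t.card * b := by
    have h := Multiset.sum_lt_sum_of_nonempty (s := t) (f := id) (g := fun _ => b) ht0 fun e he => by
      have h1 := (Multiset.mem_filter.1 (Multiset.mem_of_le ht he))
      exact lt_of_le_of_ne (hle e h1.1) h1.2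
    simpa using h
  refine ⟨r + Multiset.replicate c b, ?_, ?_, ?_⟩
  · intro e he
    rcases Multiset.mem_add.1 he with h | h
    · exact Or.inl (Multiset.mem_add.2 (Or.inr h))
    · exact Or.inr (Multiset.eq_of_mem_replicate h)
  · simp only [Multiset.sum_add, Multiset.sum_replicate, smul_eq_mul, hc]
    ring
  · have : c < t.card := by
      rw [hc, mul_comm] at hlt
      exact lt_of_mul_lt_mul_right hlt (Nat.zero_le _)
    simp only [Multiset.card_add, Multiset.card_replicate]
    omega

/-- If every entry of `m` other than `b` is at least `b - D`, the sum of `m` is bounded below. -/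
theorem Multiset.card_mul_le_sum_add {b D : ℕ} (m : Multiset ℕ)
    (h : ∀ e ∈ m, e ≠ b → b ≤ e + D) :
    m.card * b ≤ m.sum + (m.filter (· ≠ b)).card * D := by
  induction m using Multiset.induction_on with
  | empty => simp
  | cons e m ih =>
    have ih := ih fun e he => h e (Multiset.mem_cons_of_mem he)
    by_cases heb : e = b
    · subst heb
      simp only [Multiset.card_cons, Multiset.sum_cons, ne_eq, not_true_eq_false,
        not_false_eq_true, Multiset.filter_cons_of_neg, add_mul] at ih ⊢
      omega
    · have := h e (Multiset.mem_cons_self _ _) heb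
      rw [Multiset.filter_cons_of_pos m (p := (· ≠ b)) heb]
      simp only [Multiset.card_cons, Multiset.sum_cons, add_mul]
      omega

/-- Corollary 4.2 (combinatorial form): for `j ≥ M = a_n + (a_n - 1)·Σ_{i=1}^{n-1}(a_n - a_i)`,
the monoid `S` generated by `(0, j), (a_1, j - a_1), …, (a_n, j - a_n), (j, 0)` satisfies
the Cohen–Macaulay criterion: if `s + (0, j) ∈ S` and `s + (j, 0) ∈ S` then `s ∈ S`. -/
theorem stmt13 (n : ℕ) (hn : 1 ≤ n) (a : ℕ → ℕ)
    (hpos : ∀ i, 1 ≤ i → i ≤ n → 0 < a i)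
    (hmono : ∀ i k, 1 ≤ i → i < k → k ≤ n → a i < a k)
    (j : ℕ)
    (hj : a n + (a n - 1) * (∑ i ∈ Finset.Icc 1 (n - 1), (a n - a i)) ≤ j) :
    ∀ s : ℤ × ℤ, s + ((0 : ℤ), (j : ℤ)) ∈ SmonCZ n j a →
      s + ((j : ℤ), (0 : ℤ)) ∈ SmonCZ n j a → s ∈ SmonCZ n j a := by
  have hbpos : 0 < a n := hpos n hn le_rfl
  have hmax : ∀ i, 1 ≤ i → i ≤ n → a i ≤ a n := fun i h1 h2 => by
    rcases h2.lt_or_eq with h | rfl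
    exacts [(hmono i n h1 h le_rfl).le, le_rfl]
  set D := ∑ i ∈ Finset.Icc 1 (n - 1), (a n - a i) with hD
  have haj : ∀ i, 1 ≤ i → i ≤ n → a i ≤ j := fun i h1 h2 =>
    (hmax i h1 h2).trans ((Nat.le_add_right _ _).trans hj)
  have hjpos : 0 < j := hbpos.trans_le (haj n hn le_rfl)
  rintro ⟨x, y⟩ ⟨⟨p, p'⟩, hp, hpe⟩ ⟨⟨q, q'⟩, hq, hqe⟩
  simp only [Prod.mk_add_mk, Prod.mk.injEq, add_zero] at hpe hqe
  obtain ⟨rfl, hy⟩ := hpe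
  obtain ⟨hx, rfl⟩ := hqe
  obtain rfl : p' = q' + j := by omega
  obtain rfl : q = p + j := by omega
  refine ⟨(p, q'), ?_, rfl⟩
  rw [mem_SmonC_iff haj] at hp hq ⊢
  obtain ⟨u, k, m, h1, h2, h3⟩ := hp
  obtain ⟨v, l, r, g1, g2, g3⟩ := hq
  simp only at h2 h3 g2 g3 ⊢
  rcases l with _ | l
  swap
  · refine ⟨v, l, r, g1, ?_, ?_⟩ <;> simp only [add_mul, one_mul] at g2 g3 ⊢ <;> omega
  rcases u with _ | u
  swap
  · refine ⟨u, k, m, h1, h2, ?_⟩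
    simp only [add_mul, one_mul] at h3 ⊢
    omega
  have hmle : ∀ e ∈ m, e ≤ a n := fun e he => by
    obtain ⟨i, hi1, hi2, rfl⟩ := h1 e he
    exact hmax i hi1 hi2
  rcases le_or_gt (a n) (m.filter (· ≠ a n)).card with hc | hc
  · obtain ⟨m', hm1, hm2, hm3⟩ := m.exists_card_lt_sum_eq hbpos hmle hc
    obtain ⟨w, hw⟩ := Nat.exists_eq_add_of_lt hm3
    refine ⟨w, k, m', ?_, by rw [h2, hm2], ?_⟩
    · intro e he
      rcases hm1 e he with h | rfl
      exacts [h1 e h, ⟨n, hn, le_rfl, rfl⟩]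
    · rw [hw] at h3
      simp only [add_mul, one_mul, zero_mul] at h3 ⊢
      omega
  · exfalso
    have hlow := m.card_mul_le_sum_add (b := a n) (D := D) fun e he hne => by
      obtain ⟨i, hi1, hi2, rfl⟩ := h1 e he
      have hin : i ≠ n := by rintro rfl; exact hne rfl
      have : a n - a i ≤ D := Finset.single_le_sum (f := fun i => a n - a i)
        (fun _ _ => Nat.zero_le _) (Finset.mem_Icc.2 ⟨hi1, by omega⟩)
      omega
    have hup : r.sum ≤ r.card * a n := Multiset.sum_le_card_nsmul r (a n) fun e he => by
      obtain ⟨i, hi1, hi2, rfl⟩ := g1 e he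
      exact hmax i hi1 hi2
    have hE : (m.filter (· ≠ a n)).card * D ≤ (a n - 1) * D :=
      Nat.mul_le_mul_right _ (by omega)
    have hcard : 0 + k + m.card = v + 0 + r.card :=
      Nat.eq_of_mul_eq_mul_right hjpos (by omega)
    have hrk : r.card * a n ≤ k * a n + m.card * a n := by
      rw [← add_mul]
      exact Nat.mul_le_mul_right _ (by omega)
    have hkj : k * a n ≤ k * j := Nat.mul_le_mul_left _ (haj n hn le_rfl)
    omega
end

section
/- Proposition 5.2 (combinatorial core): Assume that (r_i, t_{d−i}) ∈ S for all i = 1, …, d − 1 (the arithmetically Cohen–Macaulay criterion) and that both S_1 and S_2 are symmetric. Then the poset (AP_S, ≤_S) has a maximum element if and only if d divides F(S_1) + F(S_2); moreover, when d divides F(S_1) + F(S_2), the maximum of (AP_S, ≤_S) is the element (F(S_1) + d, F(S_2) + d). -/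
/-- Membership of an integer in (the image in `ℤ` of) a submonoid of `ℕ`. -/
def memZ (S : AddSubmonoid ℕ) (x : ℤ) : Prop := ∃ y : ℕ, y ∈ S ∧ (y : ℤ) = x

/-- Every element of `S` is an Apery element plus a multiple of `d`. -/
theorem exists_aperyN_add_mul (S : AddSubmonoid ℕ) {d : ℕ} (hd : 0 < d) (x : ℕ) (hx : x ∈ S) :
    ∃ y ∈ AperyN S d, ∃ k, x = y + k * d := by
  induction x using Nat.strong_induction_on with
  | _ x ih =>
    by_cases h : ∃ s ∈ S, x = s + d
    · obtain ⟨s, hs, rfl⟩ := h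
      obtain ⟨y, hy, k, hk⟩ := ih s (by omega) hs
      exact ⟨y, hy, k + 1, by rw [hk]; ring⟩
    · exact ⟨x, ⟨hx, h⟩, 0, by simp⟩

theorem zero_mem_aperyN (S : AddSubmonoid ℕ) {d : ℕ} (hd : 0 < d) : 0 ∈ AperyN S d :=
  ⟨S.zero_mem, by rintro ⟨s, -, hs⟩; omega⟩

theorem memZ_natCast (S : AddSubmonoid ℕ) (x : ℕ) : memZ S x ↔ x ∈ S := by
  constructor
  · rintro ⟨y, hy, h⟩
    rwa [← Nat.cast_injective h]
  · exact fun h => ⟨x, h, rfl⟩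

theorem mem_aperyN_iff_memZ (S : AddSubmonoid ℕ) (d x : ℕ) :
    x ∈ AperyN S d ↔ x ∈ S ∧ ¬ memZ S ((x : ℤ) - d) := by
  refine and_congr_right fun _ => not_congr ?_
  constructor
  · rintro ⟨s, hs, rfl⟩
    exact ⟨s, hs, by push_cast; ring⟩
  · rintro ⟨s, hs, h⟩
    exact ⟨s, hs, by omega⟩

section Frobenius

variable {S : AddSubmonoid ℕ} {d : ℕ} {F : ℤ}

theorem neg_one_le_of_isGreatest (hF : IsGreatest {x : ℤ | ¬ memZ S x} F) : -1 ≤ F :=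
  hF.2 (by rintro ⟨y, -, hy⟩; omega)

/-- The Apery element attached to the Frobenius number. -/
theorem frobenius_add_mem_aperyN (hd : 0 < d) (hF : IsGreatest {x : ℤ | ¬ memZ S x} F) :
    (F + d).toNat ∈ AperyN S d := by
  have hF0 := neg_one_le_of_isGreatest hF
  have hcast : (((F + d).toNat : ℕ) : ℤ) = F + d := Int.toNat_of_nonneg (by omega)
  rw [mem_aperyN_iff_memZ, hcast, ← memZ_natCast, hcast, add_sub_cancel_right]
  refine ⟨?_, hF.1⟩
  by_contra h
  have := hF.2 h
  omega

theorem le_frobenius_add_of_mem_aperyN (hF : IsGreatest {x : ℤ | ¬ memZ S x} F)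
    {x : ℕ} (hx : x ∈ AperyN S d) : (x : ℤ) ≤ F + d := by
  have := hF.2 ((mem_aperyN_iff_memZ S d x).1 hx).2
  omega

/-- In a symmetric semigroup every Apery element is below the Frobenius one. -/
theorem leN_frobenius_add_of_mem_aperyN
    (hsym : ∀ x : ℤ, memZ S x ∨ memZ S (F - x)) {x : ℕ} (hx : x ∈ AperyN S d) :
    leN S x (F + d).toNat := by
  obtain ⟨s, hs, h⟩ := (hsym _).resolve_left ((mem_aperyN_iff_memZ S d x).1 hx).2
  exact ⟨s, hs, by omega⟩

end Frobenius

section Curve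

variable {n d : ℕ} {a : ℕ → ℕ}

theorem mem_of_mem_smonH (h0 : a 0 = 0) (han : a n = d)
    (hmono : ∀ i j, i < j → j ≤ n → a i < a j) {p : ℕ × ℕ} (hp : p ∈ SmonH n d a) :
    p.1 ∈ Smon1 n a ∧ p.2 ∈ Smon2 n d a ∧ d ∣ p.1 + p.2 := by
  induction hp using AddSubmonoid.closure_induction with
  | mem p hp =>
    obtain ⟨i, hi, rfl⟩ := hp
    have hle : a i ≤ d := by
      rcases hi.lt_or_eq with h | rfl
      · exact han ▸ (hmono i n h le_rfl).le
      · exact han.le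
    refine ⟨?_, ?_, by simp [Nat.add_sub_cancel' hle]⟩
    · rcases Nat.eq_zero_or_pos i with rfl | h
      · simp [h0]
      · exact AddSubmonoid.subset_closure ⟨i, h, hi, rfl⟩
    · rcases hi.lt_or_eq with h | rfl
      · exact AddSubmonoid.subset_closure ⟨i, h, rfl⟩
      · simp [han]
  | zero => simp
  | add p q _ _ hp hq =>
    refine ⟨add_mem hp.1 hq.1, add_mem hp.2.1 hq.2.1, ?_⟩
    have := dvd_add hp.2.2 hq.2.2
    rwa [Prod.fst_add, Prod.snd_add, add_add_add_comm]

theorem mul_mem_smonH (h0 : a 0 = 0) (han : a n = d) (k l : ℕ) :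
    (k * d, l * d) ∈ SmonH n d a := by
  have h1 : (d, 0) ∈ SmonH n d a :=
    AddSubmonoid.subset_closure ⟨n, le_rfl, by simp [han]⟩
  have h2 : (0, d) ∈ SmonH n d a :=
    AddSubmonoid.subset_closure ⟨0, Nat.zero_le n, by simp [h0]⟩
  simpa using add_mem (nsmul_mem h1 k) (nsmul_mem h2 l)

/-- Under the Cohen–Macaulay criterion, `S` consists of the pairs in `S₁ × S₂` whose
coordinates sum to a multiple of `d`. -/
theorem mem_smonH_iff (hd : 0 < d) (h0 : a 0 = 0) (han : a n = d)
    (hmono : ∀ i j, i < j → j ≤ n → a i < a j) {r t : ℕ → ℕ}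
    (hr : ∀ i, i < d → ∀ y ∈ AperyN (Smon1 n a) d, y % d = i → y = r i)
    (ht : ∀ i, i < d → ∀ y ∈ AperyN (Smon2 n d a) d, y % d = i → y = t i)
    (hACM : ∀ i, 1 ≤ i → i ≤ d - 1 → ((r i, t (d - i)) : ℕ × ℕ) ∈ SmonH n d a) (x y : ℕ) :
    (x, y) ∈ SmonH n d a ↔ x ∈ Smon1 n a ∧ y ∈ Smon2 n d a ∧ d ∣ x + y := by
  refine ⟨fun h => mem_of_mem_smonH h0 han hmono h, ?_⟩
  rintro ⟨hx, hy, hxy⟩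
  obtain ⟨u, hu, k, rfl⟩ := exists_aperyN_add_mul _ hd x hx
  obtain ⟨v, hv, l, rfl⟩ := exists_aperyN_add_mul _ hd y hy
  have huv : d ∣ u + v := by
    rw [add_add_add_comm, ← add_mul] at hxy
    exact (Nat.dvd_add_left (Dvd.intro_left _ rfl)).1 hxy
  suffices h : (u, v) ∈ SmonH n d a by
    simpa using add_mem h (mul_mem_smonH h0 han k l)
  have hud := Nat.mod_lt u hd
  have hvd := Nat.mod_lt v hd
  have hmod : d ∣ u % d + v % d := by
    rwa [Nat.dvd_iff_mod_eq_zero, ← Nat.add_mod, ← Nat.dvd_iff_mod_eq_zero]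
  rcases Nat.eq_zero_or_pos (u % d) with h | h
  · have hv0 : v % d = 0 := by
      rw [h, zero_add] at hmod
      exact Nat.eq_zero_of_dvd_of_lt hmod hvd
    have hu' : u = 0 := (hr 0 hd u hu h).trans
      (hr 0 hd 0 (zero_mem_aperyN _ hd) (Nat.zero_mod d)).symm
    have hv' : v = 0 := (ht 0 hd v hv hv0).trans
      (ht 0 hd 0 (zero_mem_aperyN _ hd) (Nat.zero_mod d)).symm
    rw [hu', hv']
    exact zero_mem _
  · have hvu : v % d = d - u % d := by
      obtain ⟨c, hc⟩ := hmod
      have hc1 : c = 1 := by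
        have hlt : c < 2 := by
          by_contra! hc2
          have := Nat.mul_le_mul_left d hc2
          omega
        have hpos : c ≠ 0 := by rintro rfl; omega
        omega
      rw [hc1] at hc
      omega
    rw [hr _ hud u hu rfl, ht _ hvd v hv rfl, hvu]
    exact hACM _ h (by omega)

/-- The Apery set of `S` in terms of those of `S₁` and `S₂`. -/
theorem mem_aperyP_iff
    (hS : ∀ x y, (x, y) ∈ SmonH n d a ↔ x ∈ Smon1 n a ∧ y ∈ Smon2 n d a ∧ d ∣ x + y) (x y : ℕ) :
    (x, y) ∈ AperyP (SmonH n d a) d ↔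
      x ∈ AperyN (Smon1 n a) d ∧ y ∈ AperyN (Smon2 n d a) d ∧ d ∣ x + y := by
  constructor
  · rintro ⟨h, h2, h1⟩
    obtain ⟨hx, hy, hxy⟩ := (hS x y).1 h
    refine ⟨⟨hx, ?_⟩, ⟨hy, ?_⟩, hxy⟩
    · rintro ⟨s, hs, rfl⟩
      refine h1 ⟨(s, y), (hS s y).2 ⟨hs, hy, ?_⟩, by simp⟩
      rwa [add_right_comm, Nat.dvd_add_self_right] at hxy
    · rintro ⟨s, hs, rfl⟩
      refine h2 ⟨(x, s), (hS x s).2 ⟨hx, hs, ?_⟩, by simp⟩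
      rwa [← add_assoc, Nat.dvd_add_self_right] at hxy
  · rintro ⟨hx, hy, hxy⟩
    refine ⟨(hS x y).2 ⟨hx.1, hy.1, hxy⟩, ?_, ?_⟩
    · rintro ⟨⟨u, v⟩, hs, h⟩
      exact hy.2 ⟨v, ((hS u v).1 hs).2.1, congrArg Prod.snd h⟩
    · rintro ⟨⟨u, v⟩, hs, h⟩
      exact hx.2 ⟨u, ((hS u v).1 hs).1, congrArg Prod.fst h⟩

end Curve

/-- If `A` meets every residue class modulo `d`, then every `x` has an additive inverse
modulo `d` in `A`. -/
theorem exists_dvd_add_of_section {d : ℕ} (hd : 0 < d) {A : Set ℕ} {f : ℕ → ℕ}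
    (hf : ∀ i, i < d → f i ∈ A ∧ f i % d = i) (x : ℕ) : ∃ y ∈ A, d ∣ x + y := by
  have hlt := Nat.mod_lt x hd
  obtain ⟨hA, hmod⟩ := hf ((d - x % d) % d) (Nat.mod_lt _ hd)
  refine ⟨_, hA, ?_⟩
  rw [Nat.dvd_iff_mod_eq_zero, Nat.add_mod, hmod, Nat.add_mod_mod, Nat.add_sub_cancel' hlt.le,
    Nat.mod_self]

/-- Proposition 5.2 (combinatorial core): under the Cohen–Macaulay criterion and
symmetry of `S₁` and `S₂`, the poset `(AP_S, ≤_S)` has a maximum iff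
`d ∣ F(S₁) + F(S₂)`, in which case the maximum is `(F(S₁) + d, F(S₂) + d)`. -/
theorem stmt14 (n d : ℕ) (a : ℕ → ℕ) (hd : 0 < d) (hn : 2 ≤ n)
    (h0 : a 0 = 0) (han : a n = d)
    (hmono : ∀ i j, i < j → j ≤ n → a i < a j)
    (hgcd : Finset.gcd (Finset.Icc 1 n) a = 1)
    (r t : ℕ → ℕ)
    (hr : ∀ i, i < d → (r i ∈ AperyN (Smon1 n a) d ∧ r i % d = i ∧
      ∀ y ∈ AperyN (Smon1 n a) d, y % d = i → y = r i))
    (ht : ∀ i, i < d → (t i ∈ AperyN (Smon2 n d a) d ∧ t i % d = i ∧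
      ∀ y ∈ AperyN (Smon2 n d a) d, y % d = i → y = t i))
    (hACM : ∀ i, 1 ≤ i → i ≤ d - 1 → ((r i, t (d - i)) : ℕ × ℕ) ∈ SmonH n d a)
    (F1 F2 : ℤ)
    (hF1 : IsGreatest {x : ℤ | ¬ memZ (Smon1 n a) x} F1)
    (hF2 : IsGreatest {x : ℤ | ¬ memZ (Smon2 n d a) x} F2)
    (hsym1 : ∀ x : ℤ, memZ (Smon1 n a) x ∨ memZ (Smon1 n a) (F1 - x))
    (hsym2 : ∀ x : ℤ, memZ (Smon2 n d a) x ∨ memZ (Smon2 n d a) (F2 - x)) :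
    ((∃ m ∈ AperyP (SmonH n d a) d,
        ∀ y ∈ AperyP (SmonH n d a) d, leP (SmonH n d a) y m)
      ↔ (d : ℤ) ∣ F1 + F2)
    ∧
    ((d : ℤ) ∣ F1 + F2 →
      (((F1 + d).toNat, (F2 + d).toNat) ∈ AperyP (SmonH n d a) d ∧
        ∀ y ∈ AperyP (SmonH n d a) d,
          leP (SmonH n d a) y ((F1 + d).toNat, (F2 + d).toNat))) := by
  have hS := mem_smonH_iff hd h0 han hmono (fun i hi => (hr i hi).2.2)
    (fun i hi => (ht i hi).2.2) hACM
  have hAP := mem_aperyP_iff hS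
  have hF1' := neg_one_le_of_isGreatest hF1
  have hF2' := neg_one_le_of_isGreatest hF2
  have hM1 := frobenius_add_mem_aperyN hd hF1
  have hM2 := frobenius_add_mem_aperyN hd hF2
  have hc1 : (((F1 + d).toNat : ℕ) : ℤ) = F1 + d := Int.toNat_of_nonneg (by omega)
  have hc2 : (((F2 + d).toNat : ℕ) : ℤ) = F2 + d := Int.toNat_of_nonneg (by omega)
  have hdvd : d ∣ (F1 + d).toNat + (F2 + d).toNat ↔ (d : ℤ) ∣ F1 + F2 := by
    rw [← Int.natCast_dvd_natCast, Nat.cast_add, hc1, hc2, add_add_add_comm, ← two_mul]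
    exact dvd_add_left (Dvd.intro_left _ rfl)
  have hmax : (d : ℤ) ∣ F1 + F2 →
      (((F1 + d).toNat, (F2 + d).toNat) ∈ AperyP (SmonH n d a) d ∧
        ∀ y ∈ AperyP (SmonH n d a) d,
          leP (SmonH n d a) y ((F1 + d).toNat, (F2 + d).toNat)) := by
    intro h
    rw [← hdvd] at h
    refine ⟨(hAP _ _).2 ⟨hM1, hM2, h⟩, ?_⟩
    rintro ⟨x, y⟩ hxy
    obtain ⟨hx, hy, hsum⟩ := (hAP x y).1 hxy
    obtain ⟨u, hu, hxu⟩ := leN_frobenius_add_of_mem_aperyN hsym1 hx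
    obtain ⟨v, hv, hyv⟩ := leN_frobenius_add_of_mem_aperyN hsym2 hy
    refine ⟨(u, v), (hS u v).2 ⟨hu, hv, ?_⟩, Prod.ext hxu hyv⟩
    rw [hxu, hyv, add_add_add_comm] at h
    exact (Nat.dvd_add_right hsum).1 h
  refine ⟨⟨?_, fun h => ⟨_, hmax h⟩⟩, hmax⟩
  rintro ⟨⟨m1, m2⟩, hm, hle⟩
  obtain ⟨hm1, hm2, hm12⟩ := (hAP m1 m2).1 hm
  obtain ⟨y, hy, hdy⟩ := exists_dvd_add_of_section hd
    (fun i hi => ⟨(ht i hi).1, (ht i hi).2.1⟩) (F1 + d).toNat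
  obtain ⟨x, hx, hdx⟩ := exists_dvd_add_of_section hd
    (fun i hi => ⟨(hr i hi).1, (hr i hi).2.1⟩) (F2 + d).toNat
  obtain ⟨⟨u, _⟩, -, hu⟩ := hle _ ((hAP _ _).2 ⟨hM1, hy, hdy⟩)
  obtain ⟨⟨_, v⟩, -, hv⟩ := hle _ ((hAP _ _).2 ⟨hx, hM2, by rwa [add_comm]⟩)
  have hu' : m1 = (F1 + d).toNat + u := congrArg Prod.fst hu
  have hv' : m2 = (F2 + d).toNat + v := congrArg Prod.snd hv
  have hb1 := le_frobenius_add_of_mem_aperyN hF1 hm1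
  have hb2 := le_frobenius_add_of_mem_aperyN hF2 hm2
  have he1 : m1 = (F1 + d).toNat := by omega
  have he2 : m2 = (F2 + d).toNat := by omega
  rwa [he1, he2, hdvd] at hm12
end

section
/- Lemma 5.6: Let T be a symmetric numerical semigroup with 2 ∉ T. Then every minimal generator of T is strictly smaller than the Frobenius number F(T); in particular, the largest minimal generator a_n of T satisfies a_n < F(T). -/
/-- If every nonzero `s ∈ T` below `x` satisfies `s - k ∈ T` (with `k ≤ s`), then every such `s`
is a multiple of `k`, and `k ∈ T`. -/
theorem AddSubmonoid.dvd_and_mem_of_sub_mem {T : AddSubmonoid ℕ} {x k : ℕ} (hk : 0 < k)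
    (h : ∀ s ∈ T, s ≠ 0 → s < x → ∃ r ∈ T, r + k = s) (s : ℕ) :
    s ∈ T → s ≠ 0 → s < x → k ∣ s ∧ k ∈ T := by
  induction s using Nat.strong_induction_on with
  | _ s ih =>
    intro hs hs0 hsx
    obtain ⟨r, hr, rfl⟩ := h s hs hs0 hsx
    rcases eq_or_ne r 0 with rfl | hr0
    · simpa using hs
    · obtain ⟨hd, hkT⟩ := ih r (by omega) hr hr0 (by omega)
      exact ⟨hd.add (dvd_refl k), hkT⟩

/-- Lemma 5.6: if `T` is a symmetric numerical semigroup with `2 ∉ T`, then every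
minimal generator of `T` is strictly smaller than the Frobenius number `F(T)`. -/
theorem stmt16 (T : AddSubmonoid ℕ) (hfin : {x : ℕ | x ∉ T}.Finite)
    (F : ℤ) (hF : IsGreatest {x : ℤ | ¬ ∃ y : ℕ, y ∈ T ∧ (y : ℤ) = x} F)
    (hsym : ∀ x : ℤ, (∃ y : ℕ, y ∈ T ∧ (y : ℤ) = x) ∨ (∃ y : ℕ, y ∈ T ∧ (y : ℤ) = F - x))
    (h2 : (2 : ℕ) ∉ T) :
    ∀ x : ℕ, x ∈ T → x ≠ 0 →
      (¬ ∃ u v : ℕ, u ∈ T ∧ v ∈ T ∧ u ≠ 0 ∧ v ≠ 0 ∧ x = u + v) →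
      (x : ℤ) < F := by
  intro x hx _ hmin
  by_contra! hle
  have h1 : (1 : ℕ) ∉ T := fun h => h2 (T.add_mem h h)
  have hF2 : (2 : ℤ) ≤ F := hF.2 fun ⟨y, hy, hy2⟩ => h2 <| by
    rwa [show y = 2 by omega] at hy
  have hxF : (x : ℤ) ≠ F := fun h => hF.1 ⟨x, hx, h⟩
  obtain ⟨k, hk⟩ : ∃ k : ℕ, (x : ℤ) = F + k := ⟨(x - F).toNat, by omega⟩
  have hstep : ∀ s ∈ T, s ≠ 0 → s < x → ∃ r ∈ T, r + k = s := by
    intro s hs hs0 hsx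
    rcases hsym (x - s) with ⟨y, hy, hyx⟩ | ⟨y, hy, hyx⟩
    · exact absurd ⟨s, y, hs, hy, hs0, by omega, by omega⟩ hmin
    · exact ⟨y, hy, by omega⟩
  have hdvd := AddSubmonoid.dvd_and_mem_of_sub_mem (by omega) hstep
  have hgap : ∀ i : ℕ, i ∉ T → ∃ y ∈ T, (y : ℤ) = F - i := fun i hi =>
    (hsym i).resolve_left fun ⟨y, hy, hyi⟩ => hi (Nat.cast_injective hyi ▸ hy)
  obtain ⟨a, ha, haF⟩ := hgap 1 h1
  obtain ⟨b, hb, hbF⟩ := hgap 2 h2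
  have hab : a = b + 1 := by omega
  have hb0 : b ≠ 0 := by
    rintro rfl
    exact h1 (by simpa [hab] using ha)
  obtain ⟨hka, hkT⟩ := hdvd a ha (by omega) (by omega)
  obtain ⟨hkb, -⟩ := hdvd b hb hb0 (by omega)
  have hk1 : k ∣ 1 := (Nat.dvd_add_right hkb).1 (hab ▸ hka)
  exact h1 (Nat.dvd_one.1 hk1 ▸ hkT)
end

section
/- Key claim in the proof of Lemma 5.6: Let T be a symmetric numerical semigroup with 2 ∉ T. Then every y ∈ T with y > F(T) can be written as y = z₁ + z₂ with z₁, z₂ ∈ T ∖ {0}. -/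
/-- Key claim in the proof of Lemma 5.6: if `T` is a symmetric numerical semigroup with
`2 ∉ T`, then every `y ∈ T` with `y > F(T)` is a sum of two nonzero elements of `T`. -/
theorem stmt17 (T : AddSubmonoid ℕ) (hfin : {x : ℕ | x ∉ T}.Finite)
    (F : ℤ) (hF : IsGreatest {x : ℤ | ¬ ∃ y : ℕ, y ∈ T ∧ (y : ℤ) = x} F)
    (hsym : ∀ x : ℤ, (∃ y : ℕ, y ∈ T ∧ (y : ℤ) = x) ∨ (∃ y : ℕ, y ∈ T ∧ (y : ℤ) = F - x))
    (h2 : (2 : ℕ) ∉ T) :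
    ∀ y : ℕ, y ∈ T → F < (y : ℤ) →
      ∃ z₁ z₂ : ℕ, z₁ ∈ T ∧ z₂ ∈ T ∧ z₁ ≠ 0 ∧ z₂ ≠ 0 ∧ y = z₁ + z₂ := by
  classical
  intro y _ hy
  by_contra hno
  have not_mem_le : ∀ n : ℕ, n ∉ T → (n : ℤ) ≤ F := fun n hn =>
    hF.2 (by rintro ⟨k, hk, hkn⟩; exact hn (Nat.cast_injective hkn ▸ hk))
  have h1 : (1 : ℕ) ∉ T := fun h => h2 (T.add_mem h h)
  have hF2 : (2 : ℤ) ≤ F := by exact_mod_cast not_mem_le 2 h2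
  -- If `y` is indecomposable, symmetry makes `T` stable under subtracting `y - F` below `y`.
  have descend : ∀ z ∈ T, z ≠ 0 → z < y → ∃ w ∈ T, (w : ℤ) = z - (y - F) := by
    intro z hz hz0 hzy
    rcases hsym (y - z) with ⟨w, hw, hwe⟩ | ⟨w, hw, hwe⟩
    · exact (hno ⟨z, w, hz, hw, hz0, by omega, by omega⟩).elim
    · exact ⟨w, hw, by omega⟩
  obtain ⟨a, ha, haF⟩ : ∃ a ∈ T, (a : ℤ) = F - 1 := by
    rcases hsym 1 with ⟨w, hw, hwe⟩ | h
    · exact (h1 (by rwa [show w = 1 by omega] at hw)).elim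
    · exact h
  have hex : ∃ n, n ∈ T ∧ n ≠ 0 := ⟨a, ha, by omega⟩
  obtain ⟨hmT, hm0⟩ := Nat.find_spec hex
  have hmin : ∀ n ∈ T, n ≠ 0 → Nat.find hex ≤ n := fun n hn h0 => Nat.find_min' hex ⟨hn, h0⟩
  generalize Nat.find hex = m at hmT hm0 hmin
  have hma := hmin a ha (by omega)
  have hm1 : m ≠ 1 := fun h => h1 (h ▸ hmT)
  have hm2 : m ≠ 2 := fun h => h2 (h ▸ hmT)
  have hym : (y : ℤ) = F + m := by
    obtain ⟨w, hw, hwe⟩ := descend m hmT hm0 (by omega)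
    by_cases hw0 : w = 0
    · omega
    · have := hmin w hw hw0
      omega
  have hdvd : ∀ z, z ∈ T → z < y → m ∣ z := by
    intro z
    induction z using Nat.strong_induction_on with
    | _ z ih =>
      intro hz hzy
      by_cases hz0 : z = 0
      · simp [hz0]
      obtain ⟨w, hw, hwe⟩ := descend z hz hz0 hzy
      rw [show z = w + m by omega]
      exact (ih w (by omega) hw (by omega)).add (dvd_refl m)
  have mem_of_gt : ∀ n : ℕ, F < n → n ∈ T := fun n hn => by
    by_contra h
    exact (not_mem_le n h).not_gt hn
  have d1 := hdvd (a + 2) (mem_of_gt _ (by omega)) (by omega)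
  have d2 := hdvd (a + 3) (mem_of_gt _ (by omega)) (by omega)
  exact hm1 (Nat.dvd_one.mp ((Nat.dvd_add_right d1).mp d2))
end

section
/- Lemma 5.7: Let S_1 ⊊ ℕ be a numerical semigroup with S_1 ≠ ℕ, let a_1 := min(S_1 ∖ {0}), and let a := min{b ∈ S_1 : a_1 does not divide b}. If y ∈ ℕ satisfies y + i ∉ S_1 for every i ∈ {0, …, a − 1} such that a_1 does not divide i, then y = 0. -/
/-- Lemma 5.7: let `S₁ ⊊ ℕ` be a numerical semigroup, `a₁ = min(S₁ ∖ {0})` and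
`a = min{b ∈ S₁ : a₁ ∤ b}`. If `y + i ∉ S₁` for every `i ∈ {0, …, a - 1}` with `a₁ ∤ i`,
then `y = 0`. -/
theorem stmt18 (S : AddSubmonoid ℕ) (hfin : {x : ℕ | x ∉ S}.Finite) (hne : S ≠ ⊤)
    (a1 : ℕ) (ha1 : IsLeast {x : ℕ | x ∈ S ∧ x ≠ 0} a1)
    (a : ℕ) (ha : IsLeast {b : ℕ | b ∈ S ∧ ¬ a1 ∣ b} a)
    (y : ℕ) (hy : ∀ i, i < a → ¬ a1 ∣ i → y + i ∉ S) : y = 0 := by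
  obtain ⟨⟨ha1S, ha10⟩, hmin⟩ := ha1
  obtain ⟨⟨haS, hndvd⟩, -⟩ := ha
  have hmul : ∀ k, a1 ∣ k → k ∈ S := by
    rintro _ ⟨c, rfl⟩
    simpa [mul_comm] using S.nsmul_mem ha1S c
  have hle : a1 ≤ a := hmin ⟨haS, fun h => hndvd (h ▸ dvd_zero a1)⟩
  have hlt : a1 < a := lt_of_le_of_ne hle fun h => hndvd (h ▸ dvd_refl a1)
  have hy1 : a1 ∣ y := by
    by_contra h
    have hr : y % a1 < a1 := Nat.mod_lt _ (Nat.pos_of_ne_zero ha10)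
    have hsum : a1 ∣ y + (a1 - y % a1) := by
      have hd := Nat.div_add_mod y a1
      refine ⟨y / a1 + 1, ?_⟩
      rw [mul_add, mul_one]
      omega
    exact hy (a1 - y % a1) (by omega) (fun hd => h ((Nat.dvd_add_left hd).1 hsum)) (hmul _ hsum)
  by_contra hy0
  have hay : a1 ≤ y := Nat.le_of_dvd (Nat.pos_of_ne_zero hy0) hy1
  refine hy (a - a1) (by omega) (fun hd => hndvd ((Nat.dvd_sub_iff_left hle dvd_rfl).1 hd)) ?_
  rw [show y + (a - a1) = a + (y - a1) by omega]
  exact S.add_mem haS (hmul _ (Nat.dvd_sub hy1 dvd_rfl))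
end
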